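/- Suppose additionally that β = α^t for some integer t ≥ 0 and that p ≤ 1/2. Then the lower Hausdorff dimension of π satisfies dim_H π ≥ d̲(Σ_{i=0}^{α−1} i·ξ_i). (Second part of the main theorem.) -/

import Mathlib

open MeasureTheory Set Filter

/-- The lower local dimension `liminf_{r→0+} log π(B(x,r))/log r`. -/
noncomputable def lowerLocalDim (π : Measure ℝ) (x : ℝ) : ℝ :=
  liminf (fun r : ℝ => Real.log (π (Metric.ball x r)).toReal / Real.log r)
    (nhdsWithin 0 (Ioi 0))

/-- `ξ_k = Σ_{m=0}^∞ π([mα+k, mα+k+1))`, as a real number. -/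
noncomputable def xi (α : ℕ) (π : Measure ℝ) (k : ℕ) : ℝ :=
  (∑' m : ℕ, π (Ico ((m : ℝ) * α + k) ((m : ℝ) * α + k + 1))).toReal

/-- `d̄(y) = (log(1-p) + y·log p)/log(α⁻¹)`. -/
noncomputable def dBar (α : ℕ) (p y : ℝ) : ℝ :=
  (Real.log (1 - p) + y * Real.log p) / Real.log ((α : ℝ)⁻¹)

/-- `d̲(y) = d̄(y) - log(1-p^{α-1})/log(α⁻¹)`. -/
noncomputable def dLow (α : ℕ) (p y : ℝ) : ℝ :=
  dBar α p y - Real.log (1 - p ^ (α - 1)) / Real.log ((α : ℝ)⁻¹)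


def SInv (α : ℕ) (p : ℝ) (ν : Measure ℝ) : Prop :=
  ∀ A : Set ℝ, MeasurableSet A →
      ν A = ENNReal.ofReal p * ν ((fun y => y + (1 : ℝ)) ⁻¹' A)
          + ENNReal.ofReal (1 - p) * ν ((fun y => y / (α : ℝ)) ⁻¹' A)

lemma SInv.meas_eq {α : ℕ} {p : ℝ} {ν : Measure ℝ} (h : SInv α p ν) :
    ν = ENNReal.ofReal p • ν.map (fun y => y + (1 : ℝ))
      + ENNReal.ofReal (1 - p) • ν.map (fun y => y / (α : ℝ)) := by
  ext A hA
  rw [h A hA]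
  simp only [Measure.coe_add, Measure.coe_smul, Pi.add_apply, Pi.smul_apply, smul_eq_mul]
  rw [Measure.map_apply (by fun_prop) hA, Measure.map_apply (by fun_prop) hA]

lemma SInv.real {α : ℕ} {p : ℝ} {ν : Measure ℝ} [IsProbabilityMeasure ν]
    (h : SInv α p ν) (hp0 : 0 ≤ p) (hp1 : p ≤ 1) {A : Set ℝ} (hA : MeasurableSet A) :
    ν.real A = p * ν.real ((fun y => y + (1 : ℝ)) ⁻¹' A)
          + (1 - p) * ν.real ((fun y => y / (α : ℝ)) ⁻¹' A) := by
  unfold Measure.real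
  rw [h A hA, ENNReal.toReal_add (by finiteness) (by finiteness), ENNReal.toReal_mul,
    ENNReal.toReal_mul, ENNReal.toReal_ofReal hp0, ENNReal.toReal_ofReal (by linarith)]

lemma SInv.integral {E : Type*} [NormedAddCommGroup E] [NormedSpace ℝ E]
    [MeasurableSpace E] [BorelSpace E] [SecondCountableTopology E]
    {α : ℕ} {p : ℝ} {ν : Measure ℝ} [IsProbabilityMeasure ν]
    (h : SInv α p ν) (hp0 : 0 ≤ p) (hp1 : p ≤ 1) {f : ℝ → E} (hf : Measurable f)
    (C : ℝ) (hC : ∀ x, ‖f x‖ ≤ C) :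
    ∫ x, f x ∂ν = p • ∫ x, f (x + 1) ∂ν + (1 - p) • ∫ x, f (x / α) ∂ν := by
  have i1 : ∀ μ : Measure ℝ, IsFiniteMeasure μ → Integrable f μ := fun μ _ =>
    Integrable.of_bound hf.aestronglyMeasurable C (Eventually.of_forall hC)
  have : IsProbabilityMeasure (ν.map (fun y => y + (1 : ℝ))) :=
    Measure.isProbabilityMeasure_map (by fun_prop)
  have : IsProbabilityMeasure (ν.map (fun y => y / (α : ℝ))) :=
    Measure.isProbabilityMeasure_map (by fun_prop)
  conv_lhs => rw [h.meas_eq]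
  rw [integral_add_measure ((i1 _ inferInstance).smul_measure (by finiteness))
    ((i1 _ inferInstance).smul_measure (by finiteness)), integral_smul_measure,
    integral_smul_measure, integral_map (by fun_prop) hf.aestronglyMeasurable,
    integral_map (by fun_prop) hf.aestronglyMeasurable,
    ENNReal.toReal_ofReal hp0, ENNReal.toReal_ofReal (by linarith)]

lemma charFun_cont (μ : Measure ℝ) [IsProbabilityMeasure μ] : Continuous (charFun μ) := by
  have : charFun μ = fun t : ℝ => ∫ x, Complex.exp (t * x * Complex.I) ∂μ := by
    ext t; exact charFun_apply_real t
  rw [this]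
  refine continuous_of_dominated (bound := fun _ => 1) ?_ ?_ (integrable_const _) ?_
  · intro t; exact (by fun_prop : Measurable _).aestronglyMeasurable
  · intro t; refine Eventually.of_forall fun x => ?_
    have := Complex.norm_exp_ofReal_mul_I (t * x)
    push_cast at this; exact this.le
  · refine Eventually.of_forall fun x => ?_
    fun_prop

lemma SInv.charFun_eq {α : ℕ} {p : ℝ} {ν : Measure ℝ} [IsProbabilityMeasure ν]
    (h : SInv α p ν) (hp0 : 0 ≤ p) (hp1 : p ≤ 1) (t : ℝ) :
    (1 - p * Complex.exp (t * Complex.I)) * charFun ν t = (1 - p) * charFun ν (t / α) := by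
  have hb : ∀ x : ℝ, ‖Complex.exp (t * x * Complex.I)‖ ≤ 1 := fun x => by
    have := Complex.norm_exp_ofReal_mul_I (t * x)
    push_cast at this; exact this.le
  have := h.integral hp0 hp1 (f := fun x : ℝ => Complex.exp (t * x * Complex.I))
    (by fun_prop) 1 hb
  have e1 : ∀ x : ℝ, Complex.exp (t * (x + 1 : ℝ) * Complex.I)
      = Complex.exp (t * Complex.I) * Complex.exp (t * x * Complex.I) := fun x => by
    rw [← Complex.exp_add]; push_cast; ring_nf
  have e2 : ∀ x : ℝ, Complex.exp (t * (x / α : ℝ) * Complex.I)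
      = Complex.exp ((t / α : ℝ) * x * Complex.I) := fun x => by
    push_cast; ring_nf
  simp only [e1, e2] at this
  rw [integral_const_mul, ← charFun_apply_real, ← charFun_apply_real] at this
  simp only [Complex.real_smul] at this
  push_cast at this
  linear_combination this

lemma SInv.unique {α : ℕ} (hα : 2 ≤ α) {p : ℝ} {μ ν : Measure ℝ} [IsProbabilityMeasure ν]
    [IsProbabilityMeasure μ] (h : SInv α p ν) (h' : SInv α p μ) (hp0 : 0 ≤ p) (hp1 : p < 1) :
    μ = ν := by
  apply Measure.ext_of_charFun
  have hα' : (2 : ℝ) ≤ α := by exact_mod_cast hα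
  set δ : ℝ → ℂ := fun t => charFun μ t - charFun ν t with hδ
  have hstep : ∀ t, ‖δ t‖ ≤ ‖δ (t / α)‖ := by
    intro t
    have e : (1 - p * Complex.exp (t * Complex.I)) * δ t = (1 - p) * δ (t / α) := by
      simp only [hδ]
      linear_combination h'.charFun_eq hp0 hp1.le t - h.charFun_eq hp0 hp1.le t
    have e2 := congrArg norm e
    rw [norm_mul, norm_mul] at e2
    have n1 : ‖(1 - p : ℂ)‖ = 1 - p := by
      have : (1 - p : ℂ) = ((1 - p : ℝ) : ℂ) := by push_cast; rfl
      rw [this, Complex.norm_real, Real.norm_of_nonneg (by linarith)]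
    have n2 : 1 - p ≤ ‖(1 - p * Complex.exp (t * Complex.I) : ℂ)‖ := by
      have := norm_sub_norm_le (1 : ℂ) (p * Complex.exp (t * Complex.I))
      rw [norm_mul, Complex.norm_exp_ofReal_mul_I, Complex.norm_real,
        Real.norm_of_nonneg hp0] at this
      simpa using this
    rw [n1] at e2
    have : (1 - p) * ‖δ t‖ ≤ (1 - p) * ‖δ (t / α)‖ := by
      rw [← e2]; exact mul_le_mul_of_nonneg_right n2 (norm_nonneg _)
    exact le_of_mul_le_mul_left this (by linarith)
  have hiter : ∀ (n : ℕ) t, ‖δ t‖ ≤ ‖δ (t / α ^ n)‖ := by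
    intro n
    induction n with
    | zero => intro t; simp
    | succ k ih =>
      intro t
      refine (ih t).trans ((hstep _).trans_eq ?_)
      rw [div_div, pow_succ]
  have hcont : Continuous δ := (charFun_cont μ).sub (charFun_cont ν)
  have h0 : δ 0 = 0 := by simp [hδ]
  funext t
  have hlim : Tendsto (fun n : ℕ => ‖δ (t / α ^ n)‖) atTop (nhds 0) := by
    have h1 : Tendsto (fun n : ℕ => t / (α : ℝ) ^ n) atTop (nhds 0) :=
      tendsto_const_nhds.div_atTop (tendsto_pow_atTop_atTop_of_one_lt (by linarith))
    have := (hcont.norm.tendsto 0).comp h1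
    simpa [h0, Function.comp_def] using this
  have : ‖δ t‖ ≤ 0 := ge_of_tendsto' hlim (fun n => hiter n t)
  have := norm_le_zero_iff.1 this
  exact sub_eq_zero.1 this

/-- invariance of periodic sets -/
lemma SInv.periodic {α : ℕ} (hα : 2 ≤ α) {p : ℝ} {ν : Measure ℝ} [IsProbabilityMeasure ν]
    (h : SInv α p ν) (hp0 : 0 ≤ p) (hp1 : p < 1) {A : Set ℝ} (hA : MeasurableSet A)
    (hper : ∀ x : ℝ, x + α ∈ A ↔ x ∈ A) :
    ν.real ((fun x => (α : ℝ) * x) ⁻¹' A) = ν.real A := by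
  have hα0 : (α : ℝ) ≠ 0 := by positivity
  have := h.real hp0 hp1.le (A := (fun x => (α : ℝ) * x) ⁻¹' A)
    (hA.preimage (by fun_prop))
  have e1 : (fun y : ℝ => y + 1) ⁻¹' ((fun x => (α : ℝ) * x) ⁻¹' A)
      = (fun x => (α : ℝ) * x) ⁻¹' A := by
    ext x; simp only [mem_preimage, mul_add, mul_one]; exact hper _
  have e2 : (fun y : ℝ => y / α) ⁻¹' ((fun x => (α : ℝ) * x) ⁻¹' A) = A := by
    ext x; simp only [mem_preimage]; rw [mul_div_cancel₀ _ hα0]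
  rw [e1, e2] at this
  have h3 : (1 - p) * ν.real ((fun x => (α : ℝ) * x) ⁻¹' A) = (1 - p) * ν.real A := by
    linarith
  exact mul_left_cancel₀ (by linarith) h3

lemma SInv.periodic_integral {α : ℕ} (hα : 2 ≤ α) {p : ℝ} {ν : Measure ℝ}
    [IsProbabilityMeasure ν]
    (h : SInv α p ν) (hp0 : 0 ≤ p) (hp1 : p < 1) {f : ℝ → ℝ} (hf : Measurable f) (C : ℝ)
    (hC : ∀ x, ‖f x‖ ≤ C)
    (hper : ∀ x, f (x + α) = f x) :
    ∫ x, f (α * x) ∂ν = ∫ x, f x ∂ν := by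
  have hα0 : (α : ℝ) ≠ 0 := by positivity
  have := h.integral hp0 hp1.le (f := fun x => f (α * x)) (hf.comp (by fun_prop)) C
    (fun x => hC _)
  simp only [mul_add, mul_one, hper, mul_div_cancel₀ _ hα0, smul_eq_mul] at this
  have h3 : (1 - p) * ∫ x, f (α * x) ∂ν = (1 - p) * ∫ x, f x ∂ν := by
    linarith
  exact mul_left_cancel₀ (by linarith) h3

lemma aux_C {p q s u : ℝ} (hp0 : 0 < p) (hq : q = p * Real.exp s) (hq1 : q < 1) (hu0 : 0 ≤ u)
    (hus : u ≤ s) : (1 - p) ≤ Real.exp (q / (1 - q) * u) * (1 - p * Real.exp u) := by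
  have h1 : p * Real.exp u ≤ q := by
    rw [hq]; gcongr
  have h2 : Real.exp u - 1 ≤ u * Real.exp u := by
    have := Real.add_one_le_exp (-u)
    rw [Real.exp_neg] at this
    have h3 := mul_le_mul_of_nonneg_right this (Real.exp_pos u).le
    rw [inv_mul_cancel₀ (Real.exp_pos u).ne'] at h3
    linarith
  have h3 := Real.add_one_le_exp (q / (1 - q) * u)
  have hq0 : 0 < q := by rw [hq]; positivity
  have h4 : 0 < 1 - q := by linarith
  have h5 : (q / (1 - q) * u + 1) * (1 - p * Real.exp u) ≤
      Real.exp (q / (1 - q) * u) * (1 - p * Real.exp u) :=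
    mul_le_mul_of_nonneg_right h3 (by linarith)
  refine le_trans ?_ h5
  have h6 : q * u ≤ q / (1 - q) * u * (1 - p * Real.exp u) := by
    have : q * u = q / (1 - q) * u * (1 - q) := by field_simp
    rw [this]
    gcongr
  have h7 : p * (Real.exp u - 1) ≤ q * u := by
    calc p * (Real.exp u - 1) ≤ p * (u * Real.exp u) := by gcongr
      _ = (p * Real.exp u) * u := by ring
      _ ≤ q * u := by gcongr
  nlinarith

lemma SInv.expo {α : ℕ} (hα : 2 ≤ α) {p : ℝ} {ν : Measure ℝ} [IsProbabilityMeasure ν]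
    (h : SInv α p ν) (hp0 : 0 < p) (hp1 : p < 1) {s q : ℝ} (hs : 0 ≤ s)
    (hq : q = p * Real.exp s) (hq1 : q < 1) (K : ℝ) (hK : 1 ≤ K) :
    ∫ x, min (Real.exp (s * x)) K ∂ν ≤ Real.exp (q / (1 - q) * (2 * s)) := by
  have hα' : (2 : ℝ) ≤ α := by exact_mod_cast hα
  set F : ℕ → ℝ → ℝ := fun n x => min (Real.exp (s / α ^ n * x)) K with hF
  have hFm : ∀ n, Measurable (F n) := fun n => by simp only [hF]; fun_prop
  have hF0 : ∀ n x, 0 ≤ F n x := fun n x => le_min (Real.exp_pos _).le (by linarith)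
  have hFb : ∀ n x, ‖F n x‖ ≤ K := fun n x => by
    rw [Real.norm_of_nonneg (hF0 n x)]; exact min_le_right _ _
  have hI : ∀ n, Integrable (F n) ν := fun n =>
    Integrable.of_bound (hFm n).aestronglyMeasurable K (Eventually.of_forall (hFb n))
  set c := q / (1 - q) with hc
  have hq0 : 0 < q := by rw [hq]; positivity
  have hc0 : 0 ≤ c := div_nonneg hq0.le (by linarith)
  have hstep : ∀ n, ∫ x, F n x ∂ν ≤ Real.exp (c * (s / α ^ n)) * ∫ x, F (n + 1) x ∂ν := by
    intro n
    have hpow : (1 : ℝ) ≤ (α : ℝ) ^ n := one_le_pow₀ (by linarith)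
    have hu0 : 0 ≤ s / (α : ℝ) ^ n := by positivity
    have hus : s / (α : ℝ) ^ n ≤ s := div_le_self hs hpow
    have h1 := h.integral hp0.le hp1.le (hFm n) K (hFb n)
    have e2 : ∀ x, F n (x / α) = F (n + 1) x := fun x => by
      simp only [hF]; congr 2; rw [pow_succ]; field_simp
    have e1 : ∀ x, F n (x + 1) ≤ Real.exp (s / α ^ n) * F n x := fun x => by
      simp only [hF]
      rw [mul_add, mul_one, Real.exp_add, mul_comm (Real.exp (s / α ^ n * x)),
        mul_min_of_nonneg _ _ (Real.exp_pos _).le]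
      refine min_le_min le_rfl ?_
      exact le_mul_of_one_le_left (by linarith) (Real.one_le_exp hu0)
    have i1 : ∫ x, F n (x + 1) ∂ν ≤ Real.exp (s / α ^ n) * ∫ x, F n x ∂ν := by
      rw [← integral_const_mul]
      refine integral_mono ?_ ((hI n).const_mul _) e1
      exact Integrable.of_bound ((hFm n).comp (by fun_prop)).aestronglyMeasurable K
        (Eventually.of_forall (fun x => hFb n _))
    simp only [e2, smul_eq_mul] at h1
    set A := ∫ x, F n x ∂ν
    set B := ∫ x, F (n + 1) x ∂ν with hB
    have hB0 : 0 ≤ B := integral_nonneg (hF0 _)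
    have h3 := aux_C hp0 hq hq1 hu0 hus
    have h4 : 0 < 1 - p * Real.exp (s / α ^ n) := by
      have : p * Real.exp (s / α ^ n) ≤ q := by rw [hq]; gcongr
      linarith
    have h5 : (1 - p * Real.exp (s / α ^ n)) * A ≤ (1 - p) * B := by
      have := mul_le_mul_of_nonneg_left i1 hp0.le
      linarith
    have h6 := mul_le_mul_of_nonneg_right h3 hB0
    have h7 : (1 - p * Real.exp (s / α ^ n)) * A ≤
        (1 - p * Real.exp (s / α ^ n)) * (Real.exp (c * (s / α ^ n)) * B) := by
      calc _ ≤ _ := h5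
        _ ≤ _ := h6
        _ = _ := by ring
    exact le_of_mul_le_mul_left h7 h4
  have hiter : ∀ n : ℕ, ∫ x, F 0 x ∂ν ≤
      Real.exp (c * (2 * s - 2 * (s / 2 ^ n))) * ∫ x, F n x ∂ν := by
    intro n
    induction n with
    | zero => simp
    | succ k ih =>
      refine ih.trans ?_
      have h1 := mul_le_mul_of_nonneg_left (hstep k)
        (Real.exp_pos (c * (2 * s - 2 * (s / 2 ^ k)))).le
      refine h1.trans ?_
      rw [← mul_assoc, ← Real.exp_add]
      refine mul_le_mul_of_nonneg_right ?_ (integral_nonneg (hF0 _))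
      apply Real.exp_le_exp.2
      rw [← mul_add]
      refine mul_le_mul_of_nonneg_left ?_ hc0
      have h2 : s / (α : ℝ) ^ k ≤ s / 2 ^ k := by gcongr
      have h3 : s / (2 : ℝ) ^ (k + 1) = s / 2 ^ k / 2 := by rw [pow_succ]; field_simp
      rw [h3]; linarith
  have hiter' : ∀ n : ℕ, ∫ x, F 0 x ∂ν ≤ Real.exp (c * (2 * s)) * ∫ x, F n x ∂ν := by
    intro n
    refine (hiter n).trans ?_
    refine mul_le_mul_of_nonneg_right ?_ (integral_nonneg (hF0 _))
    apply Real.exp_le_exp.2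
    refine mul_le_mul_of_nonneg_left ?_ hc0
    have : 0 ≤ s / (2 : ℝ) ^ n := by positivity
    linarith
  have hlim : Tendsto (fun n => ∫ x, F n x ∂ν) atTop (nhds (∫ x, (1 : ℝ) ∂ν)) := by
    refine tendsto_integral_of_dominated_convergence (fun _ => K)
      (fun n => (hFm n).aestronglyMeasurable) (integrable_const _)
      (fun n => Eventually.of_forall (hFb n)) (Eventually.of_forall fun x => ?_)
    have h1 : Tendsto (fun n : ℕ => s / (α : ℝ) ^ n) atTop (nhds 0) :=
      tendsto_const_nhds.div_atTop (tendsto_pow_atTop_atTop_of_one_lt (by linarith))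
    have h2 : Continuous fun u : ℝ => min (Real.exp (u * x)) K := by fun_prop
    have := (h2.tendsto 0).comp h1
    simpa [hF, Function.comp_def, hK] using this
  have h3 := ge_of_tendsto' (hlim.const_mul (Real.exp (c * (2 * s)))) hiter'
  simpa [hF] using h3

lemma SInv.tail {α : ℕ} (hα : 2 ≤ α) {p : ℝ} {ν : Measure ℝ} [IsProbabilityMeasure ν]
    (h : SInv α p ν) (hp0 : 0 < p) (hp1 : p < 1) :
    ∃ M : ℝ, 0 < M ∧ ∀ k : ℕ, ν.real (Ici (k : ℝ)) ≤ M * p ^ k := by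
  have hα' : (2 : ℝ) ≤ α := by exact_mod_cast hα
  have hlog : Real.log p < 0 := Real.log_neg hp0 hp1
  set s := -(3 / 4) * Real.log p with hs
  have hs0 : 0 < s := by rw [hs]; linarith
  set q := p * Real.exp s with hq
  have hq1 : q < 1 := by
    have : q = Real.exp (Real.log p + s) := by rw [Real.exp_add, Real.exp_log hp0]
    rw [this, Real.exp_lt_one_iff]; rw [hs]; linarith
  set B := Real.exp (q / (1 - q) * (2 * s))
  have hB : 0 < B := Real.exp_pos _
  have hG : ∀ y : ℝ, 0 ≤ y → ν.real (Ici y) ≤ B * Real.exp (-(s * y)) := by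
    intro y hy
    have h1 := h.expo hα hp0 hp1 hs0.le hq hq1 (Real.exp (s * y)) (Real.one_le_exp (by positivity))
    have h2 : ∫ x, (Ici y).indicator (fun _ => Real.exp (s * y)) x ∂ν ≤
        ∫ x, min (Real.exp (s * x)) (Real.exp (s * y)) ∂ν := by
      refine integral_mono ((integrable_const _).indicator measurableSet_Ici) ?_ ?_
      · refine Integrable.of_bound (C := Real.exp (s * y))
          (by fun_prop : Measurable _).aestronglyMeasurable (Eventually.of_forall fun x => ?_)
        rw [Real.norm_of_nonneg (le_min (Real.exp_pos _).le (Real.exp_pos _).le)]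
        exact min_le_right _ _
      · intro x
        by_cases hx : x ∈ Ici y
        · simp only [hx, indicator_of_mem]
          refine le_min (Real.exp_le_exp.2 ?_) le_rfl
          exact mul_le_mul_of_nonneg_left hx hs0.le
        · simp only [hx, not_false_eq_true, indicator_of_notMem]
          exact le_min (Real.exp_pos _).le (Real.exp_pos _).le
    rw [integral_indicator_const _ measurableSet_Ici, smul_eq_mul] at h2
    rw [Real.exp_neg, ← div_eq_mul_inv, le_div_iff₀ (Real.exp_pos _)]
    exact h2.trans h1
  set r := Real.exp (Real.log p / 2) with hr
  have hr0 : 0 < r := Real.exp_pos _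
  have hr1 : r < 1 := by rw [hr, Real.exp_lt_one_iff]; linarith
  have hG2 : ∀ k : ℕ, ν.real (Ici ((α : ℝ) * k)) ≤ B * (r ^ k * p ^ k) := by
    intro k
    refine (hG _ (by positivity)).trans ?_
    have e : r ^ k * p ^ k = Real.exp (k * (Real.log p / 2) + k * Real.log p) := by
      rw [Real.exp_add, hr, ← Real.exp_nat_mul, Real.exp_nat_mul (Real.log p), Real.exp_log hp0]
    rw [e]
    refine mul_le_mul_of_nonneg_left (Real.exp_le_exp.2 ?_) hB.le
    rw [hs]
    have : (2 : ℝ) * k ≤ α * k := by gcongr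
    nlinarith
  have hrec : ∀ k : ℕ, ν.real (Ici (k : ℝ)) ≤ (1 + B * ∑ i ∈ Finset.range (k + 1), r ^ i) * p ^ k := by
    intro k
    induction k with
    | zero =>
      have : ν.real (Ici ((0 : ℕ) : ℝ)) ≤ 1 := measureReal_le_one
      simp only [zero_add, Finset.range_one, Finset.sum_singleton, pow_zero, mul_one]
      linarith
    | succ k ih =>
      have h1 := h.real hp0.le hp1.le (A := Ici ((k + 1 : ℕ) : ℝ)) measurableSet_Ici
      have e1 : (fun y : ℝ => y + 1) ⁻¹' (Ici ((k + 1 : ℕ) : ℝ)) = Ici (k : ℝ) := by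
        ext x; simp
      have e2 : (fun y : ℝ => y / α) ⁻¹' (Ici ((k + 1 : ℕ) : ℝ)) = Ici ((α : ℝ) * (k + 1 : ℕ)) := by
        ext x; simp only [mem_preimage, mem_Ici]
        rw [le_div_iff₀ (by linarith), mul_comm]
      rw [e1, e2] at h1
      have h2 := hG2 (k + 1)
      have h3 := mul_le_mul_of_nonneg_left ih hp0.le
      have h4 : (1 - p) * ν.real (Ici ((α : ℝ) * (k + 1 : ℕ))) ≤ B * (r ^ (k + 1) * p ^ (k + 1)) := by
        have : 0 ≤ ν.real (Ici ((α : ℝ) * (k + 1 : ℕ))) := measureReal_nonneg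
        nlinarith
      rw [h1, Finset.sum_range_succ]
      calc _ ≤ _ := add_le_add h3 h4
        _ = _ := by ring
  refine ⟨1 + B * (1 - r)⁻¹, ?_, fun k => (hrec k).trans ?_⟩
  · have : 0 < (1 - r)⁻¹ := by rw [inv_pos]; linarith
    positivity
  · have : ∑ i ∈ Finset.range (k + 1), r ^ i ≤ (1 - r)⁻¹ := by
      rw [← tsum_geometric_of_lt_one hr0.le hr1]
      exact (summable_geometric_of_lt_one hr0.le hr1).sum_le_tsum _ (fun i _ => by positivity)
    gcongr

def cyl (α n a : ℕ) : Set ℝ := Ico ((a : ℝ) / (α : ℝ) ^ n) (((a : ℝ) + 1) / (α : ℝ) ^ n)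

def wt (α : ℕ) : ℕ → ℕ → ℕ
  | 0, a => a
  | n + 1, a => wt α n (a / α) + a % α

lemma wt_peel (α : ℕ) (hα : 2 ≤ α) (n a : ℕ) :
    wt α n a = wt α (n + 1) a + (α - 1) * (a / α ^ (n + 1)) := by
  induction n generalizing a with
  | zero =>
    simp only [wt, zero_add, pow_one]
    have := Nat.div_add_mod a α
    obtain ⟨b, rfl⟩ : ∃ b, α = b + 1 := ⟨α - 1, by omega⟩
    simp only [Nat.add_sub_cancel]
    nlinarith
  | succ n ih =>
    have h1 : wt α (n + 1) a = wt α n (a / α) + a % α := rfl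
    have h2 : wt α (n + 2) a = wt α (n + 1) (a / α) + a % α := rfl
    rw [h1, h2, ih (a / α), Nat.div_div_eq_div_mul, ← pow_succ']
    ring

lemma wt_add (α : ℕ) (hα : 2 ≤ α) (n a : ℕ) : wt α n (a + α ^ n) = wt α n a + 1 := by
  induction n generalizing a with
  | zero => simp [wt]
  | succ n ih =>
    simp only [wt]
    rw [pow_succ', Nat.add_mul_div_left _ _ (by omega), Nat.add_mul_mod_self_left, ih]
    ring

lemma wt_succ_le (α : ℕ) (hα : 2 ≤ α) (n a : ℕ) : wt α n (a + 1) ≤ wt α n a + 1 := by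
  induction n generalizing a with
  | zero => simp [wt]
  | succ n ih =>
    simp only [wt]
    rw [Nat.succ_div, Nat.add_mod_eq_ite, Nat.mod_eq_of_lt (show 1 < α by omega)]
    have hd : α ∣ a + 1 ↔ α ≤ a % α + 1 := by
      rw [Nat.dvd_iff_mod_eq_zero, Nat.add_mod_eq_ite, Nat.mod_eq_of_lt (show 1 < α by omega)]
      have := Nat.mod_lt a (show 0 < α by omega)
      by_cases hc : α ≤ a % α + 1
      · rw [if_pos hc]; omega
      · rw [if_neg hc]; omega
    by_cases hc : α ≤ a % α + 1
    · rw [if_pos (hd.2 hc), if_pos hc]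
      have := ih (a / α)
      have := Nat.mod_lt a (show 0 < α by omega)
      omega
    · rw [if_neg (fun h => hc (hd.1 h)), if_neg hc]
      simp only [add_zero]; omega

lemma wt_run (α : ℕ) (hα : 2 ≤ α) (n k : ℕ) :
    wt α n (k * α ^ n + (α ^ n - 1)) = k + n * (α - 1) := by
  induction n with
  | zero => simp [wt]
  | succ n ih =>
    have hpos : 0 < α ^ n := by positivity
    have e : k * α ^ (n + 1) + (α ^ (n + 1) - 1) = (α - 1) + α * (k * α ^ n + (α ^ n - 1)) := by
      obtain ⟨b, hb⟩ : ∃ b, α ^ n = b + 1 := ⟨α ^ n - 1, by omega⟩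
      obtain ⟨c, rfl⟩ : ∃ c, α = c + 1 := ⟨α - 1, by omega⟩
      rw [pow_succ, hb]
      have : (b + 1) * (c + 1) - 1 = b * c + b + c := by
        have : (b + 1) * (c + 1) = b * c + b + c + 1 := by ring
        omega
      rw [this]; simp only [Nat.add_sub_cancel]; ring
    simp only [wt]
    rw [e, Nat.add_mul_div_left _ _ (by omega), Nat.add_mul_mod_self_left,
      Nat.mod_eq_of_lt (by omega), Nat.div_eq_of_lt (by omega), zero_add, ih]
    ring

lemma cyl_pre_div (α : ℕ) (hα : 2 ≤ α) (n a : ℕ) :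
    (fun y : ℝ => y / (α : ℝ)) ⁻¹' cyl α (n + 1) a = cyl α n a := by
  have hα' : (0 : ℝ) < α := by positivity
  have hp : (0 : ℝ) < (α : ℝ) ^ n := by positivity
  ext x
  simp only [cyl, mem_preimage, mem_Ico, pow_succ, ← div_div]
  rw [div_le_div_iff_of_pos_right hα', div_lt_div_iff_of_pos_right hα']

lemma cyl_pre_add (α : ℕ) (hα : 2 ≤ α) (n a : ℕ) :
    (fun y : ℝ => y + 1) ⁻¹' cyl α n (a + α ^ n) = cyl α n a := by
  have hp : (0 : ℝ) < (α : ℝ) ^ n := by positivity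
  ext x
  simp only [cyl, mem_preimage, mem_Ico]
  push_cast
  rw [div_le_iff₀ hp, lt_div_iff₀ hp, div_le_iff₀ hp, lt_div_iff₀ hp]
  constructor <;> rintro ⟨h1, h2⟩ <;> constructor <;> linarith

lemma cyl_pre_add_neg (α : ℕ) (hα : 2 ≤ α) (n a : ℕ) (ha : a < α ^ n) :
    (fun y : ℝ => y + 1) ⁻¹' cyl α n a ⊆ Iio 0 := by
  have hp : (0 : ℝ) < (α : ℝ) ^ n := by positivity
  intro x
  simp only [cyl, mem_preimage, mem_Ico, mem_Iio]
  rw [lt_div_iff₀ hp]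
  rintro ⟨_, h2⟩
  have h3 : (a : ℝ) + 1 ≤ (α : ℝ) ^ n := by exact_mod_cast ha
  nlinarith

lemma cyl_meas (α n a : ℕ) : MeasurableSet (cyl α n a) := measurableSet_Ico

section
variable {α : ℕ} {p : ℝ} {ν : Measure ℝ} [IsProbabilityMeasure ν]

lemma cyl_step (h : SInv α p ν) (hα : 2 ≤ α) (hp0 : 0 < p) (hp1 : p < 1) (n a : ℕ) :
    ν.real (cyl α (n + 1) (a + α ^ (n + 1))) =
      p * ν.real (cyl α (n + 1) a) + (1 - p) * ν.real (cyl α n (a + α ^ (n + 1))) := by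
  rw [h.real hp0.le hp1.le (cyl_meas _ _ _), cyl_pre_add α hα, cyl_pre_div α hα]

lemma cyl_step0 (h : SInv α p ν) (hα : 2 ≤ α) (hp0 : 0 < p) (hp1 : p < 1)
    (hneg : ν.real (Iio 0) = 0) (n a : ℕ) (ha : a < α ^ (n + 1)) :
    ν.real (cyl α (n + 1) a) = (1 - p) * ν.real (cyl α n a) := by
  rw [h.real hp0.le hp1.le (cyl_meas _ _ _), cyl_pre_div α hα,
    measureReal_mono_null (cyl_pre_add_neg α hα _ _ ha) hneg]
  ring

lemma cyl_upper (h : SInv α p ν) (hα : 2 ≤ α) (hp0 : 0 < p) (hp1 : p < 1)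
    (hneg : ν.real (Iio 0) = 0) {M ρ : ℝ} (hM : 0 < M)
    (hMt : ∀ k : ℕ, ν.real (Ici (k : ℝ)) ≤ M * p ^ k)
    (hρ : ρ = (1 - p) / (1 - p ^ (α - 1))) (n a : ℕ) :
    ν.real (cyl α n a) ≤ M * ρ ^ n * p ^ (wt α n a) := by
  have hx1 : p ^ (α - 1) < 1 := pow_lt_one₀ hp0.le hp1 (by omega)
  have hρ0 : 0 < ρ := by rw [hρ]; exact div_pos (by linarith) (by linarith)
  induction n generalizing a with
  | zero =>
    simp only [wt, pow_zero, mul_one]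
    refine le_trans (measureReal_mono ?_) (hMt a)
    simp only [cyl, pow_zero, div_one]
    exact Ico_subset_Ici_self
  | succ n ih =>
    have key : ∀ k b : ℕ, b < α ^ (n + 1) →
        ν.real (cyl α (n + 1) (b + k * α ^ (n + 1))) ≤
          M * ρ ^ n * (1 - p) * (∑ i ∈ Finset.range (k + 1), (p ^ (α - 1)) ^ i) *
            p ^ (wt α (n + 1) (b + k * α ^ (n + 1))) := by
      intro k b hb
      induction k with
      | zero =>
        simp only [zero_mul, add_zero, zero_add, Finset.range_one, Finset.sum_singleton, pow_zero,
          mul_one]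
        rw [cyl_step0 h hα hp0 hp1 hneg n b hb]
        have h1 := ih b
        rw [wt_peel α hα n b, Nat.div_eq_of_lt hb] at h1
        simp only [mul_zero, add_zero] at h1
        have := mul_le_mul_of_nonneg_left h1 (show 0 ≤ 1 - p by linarith)
        linarith
      | succ k ihk =>
        have e : b + (k + 1) * α ^ (n + 1) = (b + k * α ^ (n + 1)) + α ^ (n + 1) := by ring
        rw [e, cyl_step h hα hp0 hp1]
        have h1 := ih (b + k * α ^ (n + 1) + α ^ (n + 1))
        rw [wt_peel α hα n, wt_add α hα] at h1
        have hq : (b + k * α ^ (n + 1) + α ^ (n + 1)) / α ^ (n + 1) = k + 1 := by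
          rw [← e, Nat.add_mul_div_right _ _ (by positivity), Nat.div_eq_of_lt hb, zero_add]
        rw [hq] at h1
        rw [wt_add α hα, Finset.sum_range_succ]
        have h2 := mul_le_mul_of_nonneg_left ihk hp0.le
        have h3 := mul_le_mul_of_nonneg_left h1 (show 0 ≤ 1 - p by linarith)
        refine (add_le_add h2 h3).trans (le_of_eq ?_)
        rw [pow_add p, pow_mul p, pow_succ p (wt _ _ _)]
        ring
    have h1 := key (a / α ^ (n + 1)) (a % α ^ (n + 1)) (Nat.mod_lt _ (by positivity))
    rw [Nat.mod_add_div' a (α ^ (n + 1))] at h1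
    refine h1.trans ?_
    have hs : ∑ i ∈ Finset.range (a / α ^ (n + 1) + 1), (p ^ (α - 1)) ^ i ≤ (1 - p ^ (α - 1))⁻¹ := by
      have hx0 : 0 ≤ p ^ (α - 1) := by positivity
      rw [← tsum_geometric_of_lt_one hx0 hx1]
      exact (summable_geometric_of_lt_one hx0 hx1).sum_le_tsum _ (fun i _ => by positivity)
    have h1p : 0 ≤ 1 - p := by linarith
    calc _ ≤ M * ρ ^ n * (1 - p) * (1 - p ^ (α - 1))⁻¹ * p ^ wt α (n + 1) a := by gcongr
      _ = _ := by rw [pow_succ ρ, hρ]; ring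

lemma unit_pos (h : SInv α p ν) (hα : 2 ≤ α) (hp0 : 0 < p) (hp1 : p < 1)
    (hneg : ν.real (Iio 0) = 0) : 0 < ν.real (Ico 0 1) := by
  have hα' : (2 : ℝ) ≤ α := by exact_mod_cast hα
  have hm : ∀ m : ℕ, (1 - p) ^ m * ν.real (Iio ((α : ℝ) ^ m)) ≤ ν.real (Iio 1) := by
    intro m
    induction m with
    | zero => simp
    | succ m ih =>
      refine le_trans ?_ ih
      have h1 := h.real hp0.le hp1.le (A := Iio ((α : ℝ) ^ m)) measurableSet_Iio
      have e2 : (fun y : ℝ => y / (α : ℝ)) ⁻¹' (Iio ((α : ℝ) ^ m)) = Iio ((α : ℝ) ^ (m + 1)) := by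
        ext x; simp only [mem_preimage, mem_Iio, pow_succ]
        rw [div_lt_iff₀ (by linarith)]
      rw [e2] at h1
      have h2 : (1 - p) * ν.real (Iio ((α : ℝ) ^ (m + 1))) ≤ ν.real (Iio ((α : ℝ) ^ m)) := by
        rw [h1]
        have : 0 ≤ p * ν.real ((fun y : ℝ => y + 1) ⁻¹' (Iio ((α : ℝ) ^ m))) := by positivity
        linarith
      rw [pow_succ, mul_assoc]
      exact mul_le_mul_of_nonneg_left h2 (pow_nonneg (by linarith) _)
  have hex : ∃ m : ℕ, 0 < ν.real (Iio ((α : ℝ) ^ m)) := by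
    by_contra hcon
    push Not at hcon
    have h0 : ∀ m : ℕ, ν (Iio ((α : ℝ) ^ m)) = 0 := fun m => by
      have := le_antisymm (hcon m) measureReal_nonneg
      rwa [measureReal_eq_zero_iff] at this
    have hU : (⋃ m : ℕ, Iio ((α : ℝ) ^ m)) = univ := by
      rw [eq_univ_iff_forall]
      intro x
      obtain ⟨m, hm⟩ := pow_unbounded_of_one_lt x (show (1 : ℝ) < α by linarith)
      exact mem_iUnion.2 ⟨m, hm⟩
    have := measure_iUnion_null h0
    rw [hU] at this
    simp at this
  obtain ⟨m, hm'⟩ := hex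
  have h3 : 0 < ν.real (Iio 1) := lt_of_lt_of_le (mul_pos (pow_pos (by linarith) _) hm') (hm m)
  have : Iio (1 : ℝ) = Iio 0 ∪ Ico 0 1 := (Iio_union_Ico_eq_Iio (by norm_num)).symm
  rw [this] at h3
  have h4 := measureReal_union_le (μ := ν) (Iio 0) (Ico (0 : ℝ) 1)
  linarith

lemma cyl_lower (h : SInv α p ν) (hα : 2 ≤ α) (hp0 : 0 < p) (hp1 : p < 1)
    (hneg : ν.real (Iio 0) = 0) (n a : ℕ) :
    ν.real (Ico 0 1) * ((1 - p) * p ^ (α - 1)) ^ n * p ^ (a / α ^ n) ≤ ν.real (cyl α n a) := by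
  have hup := unit_pos h hα hp0 hp1 hneg
  have h1p : 0 < 1 - p := by linarith
  have shift : ∀ n a : ℕ, p * ν.real (cyl α n a) ≤ ν.real (cyl α n (a + α ^ n)) := by
    intro n a
    rw [h.real hp0.le hp1.le (cyl_meas α n (a + α ^ n)), cyl_pre_add α hα]
    have : 0 ≤ (1 - p) * ν.real ((fun y : ℝ => y / (α : ℝ)) ⁻¹' cyl α n (a + α ^ n)) := by
      positivity
    linarith
  have shiftk : ∀ n k b : ℕ, p ^ k * ν.real (cyl α n b) ≤ ν.real (cyl α n (b + k * α ^ n)) := by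
    intro n k b
    induction k with
    | zero => simp
    | succ k ih =>
      have e : b + (k + 1) * α ^ n = (b + k * α ^ n) + α ^ n := by ring
      rw [e]
      refine le_trans ?_ (shift n _)
      rw [pow_succ', mul_assoc]
      exact mul_le_mul_of_nonneg_left ih hp0.le
  induction n generalizing a with
  | zero =>
    have := shiftk 0 a 0
    simp only [cyl, pow_zero, mul_one, zero_add, Nat.cast_zero, zero_div, div_one,
      Nat.div_one] at this ⊢
    linarith
  | succ n ih =>
    have h1 := shiftk (n + 1) (a / α ^ (n + 1)) (a % α ^ (n + 1))
    rw [Nat.mod_add_div' a (α ^ (n + 1))] at h1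
    refine le_trans ?_ h1
    have hlt : a % α ^ (n + 1) < α ^ (n + 1) := Nat.mod_lt _ (by positivity)
    rw [cyl_step0 h hα hp0 hp1 hneg n _ hlt]
    have h2 := ih (a % α ^ (n + 1))
    have h3 : p ^ (α - 1) ≤ p ^ (a % α ^ (n + 1) / α ^ n) := by
      apply pow_le_pow_of_le_one hp0.le hp1.le
      have : a % α ^ (n + 1) / α ^ n < α := by
        rw [Nat.div_lt_iff_lt_mul (by positivity), ← pow_succ']; exact hlt
      omega
    have h4 : ν.real (Ico 0 1) * ((1 - p) * p ^ (α - 1)) ^ n * p ^ (α - 1) ≤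
        ν.real (cyl α n (a % α ^ (n + 1))) := by
      refine le_trans ?_ h2
      gcongr
    calc _ = p ^ (a / α ^ (n + 1)) * ((1 - p) *
          (ν.real (Ico 0 1) * ((1 - p) * p ^ (α - 1)) ^ n * p ^ (α - 1))) := by ring
      _ ≤ _ := by gcongr

end

noncomputable def dg (α : ℕ) (x : ℝ) : ℝ := (((⌊x⌋ % (α : ℤ)) : ℤ) : ℝ)

noncomputable def SS (α : ℕ) (n : ℕ) (x : ℝ) : ℝ := ∑ j ∈ Finset.range n, dg α ((α : ℝ) ^ j * x)

lemma dg_nonneg {α : ℕ} (hα : 2 ≤ α) (x : ℝ) : 0 ≤ dg α x := by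
  unfold dg
  exact_mod_cast Int.emod_nonneg _ (by omega)

lemma dg_le {α : ℕ} (hα : 2 ≤ α) (x : ℝ) : dg α x ≤ α := by
  unfold dg
  exact_mod_cast (Int.emod_lt_of_pos _ (by omega)).le

lemma dg_meas (α : ℕ) : Measurable (dg α) := by
  unfold dg
  have h1 : Measurable (fun z : ℤ => (((z % (α : ℤ)) : ℤ) : ℝ)) := measurable_of_countable _
  exact h1.comp Int.measurable_floor

lemma dg_per (α : ℕ) : Function.Periodic (dg α) α := by
  intro x
  unfold dg
  rw [show (x + (α : ℝ)) = x + ((α : ℤ) : ℝ) by push_cast; rfl, Int.floor_add_intCast,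
    Int.add_emod_right]

lemma per_pow {β : Type*} {α : ℕ} {f : ℝ → β} (hf : Function.Periodic f α) (j : ℕ) :
    Function.Periodic (fun x => f ((α : ℝ) ^ j * x)) α := by
  intro x
  have := hf.nat_mul (α ^ j) ((α : ℝ) ^ j * x)
  push_cast at this
  simp only [mul_add]
  exact this

lemma SS_per (α n : ℕ) : Function.Periodic (SS α n) α := by
  intro x
  unfold SS
  exact Finset.sum_congr rfl fun j _ => per_pow (dg_per α) j x

lemma SS_meas (α n : ℕ) : Measurable (SS α n) := by
  unfold SS
  exact Finset.measurable_sum _ fun j _ => (dg_meas α).comp (by fun_prop)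

lemma SS_nonneg {α : ℕ} (hα : 2 ≤ α) (n : ℕ) (x : ℝ) : 0 ≤ SS α n x :=
  Finset.sum_nonneg fun _ _ => dg_nonneg hα _

lemma SS_div {α : ℕ} (hα : 2 ≤ α) (n : ℕ) (x : ℝ) :
    SS α (n + 1) (x / α) = dg α (x / α) + SS α n x := by
  unfold SS
  rw [Finset.sum_range_succ']
  have hα0 : (α : ℝ) ≠ 0 := by positivity
  rw [add_comm]
  congr 1
  · simp
  · refine Finset.sum_congr rfl fun j _ => ?_
    congr 1; rw [pow_succ]; field_simp

lemma SS_succ (α n : ℕ) (x : ℝ) : SS α (n + 1) x = SS α n x + dg α ((α : ℝ) ^ n * x) := by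
  unfold SS; rw [Finset.sum_range_succ]

lemma SS_add_one {α : ℕ} (hα : 2 ≤ α) (n : ℕ) (x y : ℝ) (hxy : y = x + 1 ∨ x = y + 1) :
    SS α n y ≤ SS α n x + α := by
  cases n with
  | zero => simp [SS]
  | succ n =>
    unfold SS
    rw [Finset.sum_range_succ', Finset.sum_range_succ']
    have : ∀ j, dg α ((α : ℝ) ^ (j + 1) * y) = dg α ((α : ℝ) ^ (j + 1) * x) := by
      intro j
      have key : ∀ z, dg α ((α : ℝ) ^ (j + 1) * (z + 1)) = dg α ((α : ℝ) ^ (j + 1) * z) := by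
        intro z
        have := (dg_per α).nat_mul (α ^ j) ((α : ℝ) ^ (j + 1) * z)
        push_cast at this
        rw [← this]; congr 1; rw [pow_succ]; ring
      rcases hxy with h | h
      · rw [h, key]
      · rw [h, key]
    simp only [this]
    have h1 := dg_nonneg hα ((α : ℝ) ^ 0 * x)
    have h2 := dg_le hα ((α : ℝ) ^ 0 * y)
    linarith

def Lo (b : ℝ) (u : ℕ → ℝ) : Prop := ∃ q : ℚ, (q : ℝ) < b ∧ ∃ᶠ n in atTop, u n ≤ n * q

lemma Lo_trans {b C : ℝ} {u v : ℕ → ℝ} (h : ∀ n, v n ≤ u n + C) (hu : Lo b u) : Lo b v := by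
  obtain ⟨q, hq, hf⟩ := hu
  obtain ⟨q', h1, h2⟩ := exists_rat_btwn hq
  refine ⟨q', h2, ?_⟩
  have hev : ∀ᶠ n : ℕ in atTop, C ≤ n * ((q' : ℝ) - q) := by
    have : Tendsto (fun n : ℕ => (n : ℝ) * ((q' : ℝ) - q)) atTop atTop :=
      tendsto_natCast_atTop_atTop.atTop_mul_const (by linarith)
    exact this.eventually_ge_atTop C
  refine (hf.and_eventually hev).mono fun n hn => ?_
  have := h n
  have := hn.1; have := hn.2
  linarith

def Abad (α : ℕ) (b : ℝ) : Set ℝ := {x | Lo b (fun n => SS α n x)}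

lemma Abad_meas (α : ℕ) (b : ℝ) : MeasurableSet (Abad α b) := by
  have : Abad α b = ⋃ q : ℚ, ⋃ (_ : (q : ℝ) < b), ⋂ a : ℕ, ⋃ n : ℕ, ⋃ (_ : a ≤ n),
      {x | SS α n x ≤ n * q} := by
    ext x
    simp only [Abad, Lo, mem_ofPred_eq, frequently_atTop, mem_iUnion, mem_iInter, exists_prop]
  rw [this]
  exact MeasurableSet.iUnion fun q => MeasurableSet.iUnion fun _ => MeasurableSet.iInter fun a =>
    MeasurableSet.iUnion fun n => MeasurableSet.iUnion fun _ =>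
      measurableSet_le (SS_meas α n) measurable_const

lemma Abad_add (α : ℕ) (hα : 2 ≤ α) (b x : ℝ) : x + 1 ∈ Abad α b ↔ x ∈ Abad α b :=
  ⟨fun h => Lo_trans (fun n => SS_add_one hα n (x + 1) x (Or.inr rfl)) h,
   fun h => Lo_trans (fun n => SS_add_one hα n x (x + 1) (Or.inl rfl)) h⟩

lemma Abad_div (α : ℕ) (hα : 2 ≤ α) (b x : ℝ) : x / α ∈ Abad α b ↔ x ∈ Abad α b := by
  refine ⟨fun h => Lo_trans (C := α) (fun n => ?_) h, fun h => Lo_trans (C := α) (fun n => ?_) h⟩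
  · have h1 := SS_div hα n x
    have h2 := SS_succ α n (x / α)
    have h3 := dg_nonneg hα (x / α)
    have h4 := dg_le hα ((α : ℝ) ^ n * (x / α))
    linarith
  · have h1 := SS_div hα n x
    have h2 := SS_succ α n (x / α)
    have h3 := dg_le hα (x / α)
    have h4 := dg_nonneg hα ((α : ℝ) ^ n * (x / α))
    linarith

lemma greedy {e : ℕ → ℝ} {K b : ℝ} {M : ℕ} (hK : 0 ≤ K) (he1 : ∀ j, e j ≤ K)
    (hb : 0 ≤ b)
    (hn : ∀ i, ∃ n, 1 ≤ n ∧ n ≤ M ∧ ∑ j ∈ Finset.range n, e (i + j) ≤ n * b) (N : ℕ) :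
    ∀ i, ∑ j ∈ Finset.range N, e (i + j) ≤ N * b + M * K := by
  induction N using Nat.strong_induction_on with
  | _ N ih =>
    intro i
    obtain ⟨n, h1, h2, h3⟩ := hn i
    by_cases hc : n ≤ N
    · obtain ⟨m, rfl⟩ := Nat.exists_eq_add_of_le hc
      rw [Finset.sum_range_add]
      have := ih m (by omega) (i + n)
      simp only [add_assoc] at this ⊢
      push_cast
      linarith
    · have h4 : ∑ j ∈ Finset.range N, e (i + j) ≤ ∑ j ∈ Finset.range N, K :=
        Finset.sum_le_sum fun j _ => he1 _
      simp only [Finset.sum_const, Finset.card_range, nsmul_eq_mul] at h4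
      have h5 : (N : ℝ) ≤ M := by exact_mod_cast (by omega : N ≤ M)
      have h6 : (N : ℝ) * K ≤ M * K := by gcongr
      have : 0 ≤ (N : ℝ) * b := by positivity
      linarith

section
variable {α : ℕ} {p : ℝ} {ν : Measure ℝ} [IsProbabilityMeasure ν]

lemma SInv.periodic_integral_pow (hα : 2 ≤ α) 
    (h : SInv α p ν) (hp0 : 0 ≤ p) (hp1 : p < 1) {f : ℝ → ℝ} (hf : Measurable f) (C : ℝ)
    (hC : ∀ x, ‖f x‖ ≤ C) (hper : Function.Periodic f α) (j : ℕ) :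
    ∫ x, f ((α : ℝ) ^ j * x) ∂ν = ∫ x, f x ∂ν := by
  induction j with
  | zero => simp
  | succ j ih =>
    rw [← ih, ← h.periodic_integral hα hp0 hp1 (f := fun x => f ((α : ℝ) ^ j * x))
      (hf.comp (by fun_prop)) C (fun x => hC _) (per_pow hper j)]
    simp only [pow_succ, mul_assoc]

lemma Abad_zero_one (hα : 2 ≤ α) (h : SInv α p ν) (hp0 : 0 ≤ p) (hp1 : p < 1) (b : ℝ)
    (hA : ν (Abad α b) ≠ 0) : ∀ᵐ x ∂ν, x ∈ Abad α b := by
  have hm := Abad_meas α b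
  have hpr : IsProbabilityMeasure (ProbabilityTheory.cond ν (Abad α b)) :=
    ProbabilityTheory.cond_isProbabilityMeasure hA
  have hS : SInv α p (ProbabilityTheory.cond ν (Abad α b)) := by
    intro B hB
    rw [ProbabilityTheory.cond_apply hm, ProbabilityTheory.cond_apply hm,
      ProbabilityTheory.cond_apply hm, h _ (hm.inter hB)]
    have e1 : (fun y : ℝ => y + 1) ⁻¹' (Abad α b ∩ B) = Abad α b ∩ (fun y : ℝ => y + 1) ⁻¹' B := by
      ext x; simp only [mem_preimage, mem_inter_iff, Abad_add α hα]
    have e2 : (fun y : ℝ => y / (α : ℝ)) ⁻¹' (Abad α b ∩ B)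
        = Abad α b ∩ (fun y : ℝ => y / (α : ℝ)) ⁻¹' B := by
      ext x; simp only [mem_preimage, mem_inter_iff, Abad_div α hα]
    rw [e1, e2]; ring
  have he := SInv.unique hα h hS hp0 hp1
  rw [← he]
  exact ProbabilityTheory.ae_cond_mem hm

lemma birk (hα : 2 ≤ α) (h : SInv α p ν) (hp0 : 0 ≤ p) (hp1 : p < 1) (b : ℝ)
    (hb : b < ∫ x, dg α x ∂ν) : ν (Abad α b) = 0 := by
  by_contra hA
  have hα' : (2 : ℝ) ≤ α := by exact_mod_cast hα
  have hae := Abad_zero_one hα h hp0 hp1 b hA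
  have hgood : ∀ x ∈ Abad α b, ∃ n, 1 ≤ n ∧ SS α n x ≤ n * b := by
    rintro x ⟨q, hq, hf⟩
    obtain ⟨n, hn1, hn2⟩ := (frequently_atTop.1 hf) 1
    exact ⟨n, hn1, hn2.trans (by gcongr)⟩
  have hb0 : 0 ≤ b := by
    obtain ⟨x, hx⟩ := hae.exists
    obtain ⟨n, hn1, hn2⟩ := hgood x hx
    have h1 := (SS_nonneg hα n x).trans hn2
    have : (0 : ℝ) < n := by exact_mod_cast hn1
    exact nonneg_of_mul_nonneg_right h1 this
  set G : ℕ → Set ℝ := fun M => {x | ∃ n, 1 ≤ n ∧ n ≤ M ∧ SS α n x ≤ n * b} with hG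
  have hGm : ∀ M, MeasurableSet (G M) := by
    intro M
    have : G M = ⋃ n : ℕ, ⋃ (_ : 1 ≤ n), ⋃ (_ : n ≤ M), {x | SS α n x ≤ n * b} := by
      ext x; simp only [hG, mem_ofPred_eq, mem_iUnion, exists_prop]
    rw [this]
    exact MeasurableSet.iUnion fun n => MeasurableSet.iUnion fun _ => MeasurableSet.iUnion fun _ =>
      measurableSet_le (SS_meas α n) measurable_const
  have hGmono : Monotone G := by
    rintro M M' hM x ⟨n, h1, h2, h3⟩
    exact ⟨n, h1, h2.trans hM, h3⟩
  have hGU : ν (⋃ M, G M) = 1 := by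
    rw [← prob_compl_eq_zero_iff (MeasurableSet.iUnion hGm)]
    have : ∀ᵐ x ∂ν, x ∈ ⋃ M, G M := by
      filter_upwards [hae] with x hx
      obtain ⟨n, hn1, hn2⟩ := hgood x hx
      exact mem_iUnion.2 ⟨n, n, hn1, le_rfl, hn2⟩
    exact this
  have hlim : Tendsto (fun M => ν.real (G M)) atTop (nhds 1) := by
    have := tendsto_measure_iUnion_atTop (μ := ν) hGmono
    rw [hGU] at this
    have h2 := (ENNReal.tendsto_toReal ENNReal.one_ne_top).comp this
    exact h2
  set μ := ∫ x, dg α x ∂ν with hμ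
  obtain ⟨M, hM⟩ := (hlim.eventually (lt_mem_nhds (show 1 - (μ - b) / (2 * α) < 1 by
    have : 0 < (μ - b) / (2 * α) := div_pos (by linarith) (by linarith)
    linarith))).exists
  have hper : Function.Periodic (fun x => x ∈ G M) α := by
    intro x
    simp only [hG, mem_ofPred_eq, SS_per α _ x]
  set D := (G M).indicator (dg α) with hD
  have hD0 : ∀ x, 0 ≤ D x := fun x => indicator_nonneg (fun y _ => dg_nonneg hα y) x
  have hDdg : ∀ x, D x ≤ dg α x := fun x => indicator_le_self' (fun y _ => dg_nonneg hα y) x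
  have hDα : ∀ x, D x ≤ α := fun x => (hDdg x).trans (dg_le hα x)
  have hDm : Measurable D := (dg_meas α).indicator (hGm M)
  have hDn : ∀ x, ‖D x‖ ≤ α := fun x => by rw [Real.norm_of_nonneg (hD0 x)]; exact hDα x
  have hDper : Function.Periodic D α := by
    intro x
    have h1 : (x + (α : ℝ) ∈ G M) = (x ∈ G M) := hper x
    by_cases hx : x ∈ G M
    · rw [hD, indicator_of_mem hx, indicator_of_mem (h1 ▸ hx), dg_per α x]
    · rw [hD, indicator_of_notMem hx, indicator_of_notMem (h1 ▸ hx)]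
  have hDi : ∀ j : ℕ, Integrable (fun x => D ((α : ℝ) ^ j * x)) ν := fun j =>
    Integrable.of_bound (hDm.comp (by fun_prop)).aestronglyMeasurable α
      (Eventually.of_forall fun x => hDn _)
  have hsum : ∀ (N : ℕ) x, ∑ j ∈ Finset.range N, D ((α : ℝ) ^ j * x) ≤ N * b + M * α := by
    intro N x
    rcases Nat.eq_zero_or_pos M with hM0 | hM0
    · have : ∀ y, D y = 0 := by
        intro y
        apply indicator_of_notMem
        rintro ⟨n, h1, h2, _⟩; omega
      simp only [this, Finset.sum_const_zero]; positivity
    have := greedy (e := fun j => D ((α : ℝ) ^ j * x)) (K := α) (b := b) (M := M)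
      (by positivity) (fun j => hDα _) hb0 (fun i => ?_) N 0
    · simpa using this
    · by_cases hi : (α : ℝ) ^ i * x ∈ G M
      · obtain ⟨n, h1, h2, h3⟩ := hi
        refine ⟨n, h1, h2, le_trans ?_ h3⟩
        unfold SS
        refine Finset.sum_le_sum fun j _ => ?_
        refine (hDdg _).trans_eq ?_
        congr 1; rw [pow_add]; ring
      · refine ⟨1, le_rfl, hM0, ?_⟩
        have : D ((α : ℝ) ^ i * x) = 0 := indicator_of_notMem hi _
        simp [this, hb0]
  have hint : ∀ N : ℕ, (N : ℝ) * ∫ x, D x ∂ν ≤ N * b + M * α := by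
    intro N
    have h1 : ∫ x, ∑ j ∈ Finset.range N, D ((α : ℝ) ^ j * x) ∂ν ≤ ∫ x, (N * b + M * α : ℝ) ∂ν :=
      integral_mono (integrable_finsetSum _ fun j _ => hDi j) (integrable_const _) (hsum N)
    rw [integral_finsetSum _ fun j _ => hDi j] at h1
    simp only [h.periodic_integral_pow hα hp0 hp1 hDm α hDn hDper] at h1
    simpa using h1
  have hDb : ∫ x, D x ∂ν ≤ b := by
    by_contra hcon
    push Not at hcon
    obtain ⟨N, hN⟩ := exists_nat_gt ((M * α : ℝ) / ((∫ x, D x ∂ν) - b))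
    rw [div_lt_iff₀ (by linarith)] at hN
    have := hint N
    linarith
  have hfin : μ ≤ ∫ x, D x ∂ν + α * ν.real (G M)ᶜ := by
    have h1 : ∫ x, dg α x ∂ν ≤ ∫ x, (D x + (G M)ᶜ.indicator (fun _ => (α : ℝ)) x) ∂ν := by
      have hDi0 : Integrable D ν := by simpa using hDi 0
      refine integral_mono ?_ (hDi0.add ((integrable_const _).indicator (hGm M).compl)) ?_
      · refine Integrable.of_bound (dg_meas α).aestronglyMeasurable α
          (Eventually.of_forall fun x => ?_)
        rw [Real.norm_of_nonneg (dg_nonneg hα x)]; exact dg_le hα x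
      · intro x
        by_cases hx : x ∈ G M
        · simp [hD, hx]
        · simp [hD, hx, dg_le hα x]
    rw [integral_add (by simpa using hDi 0) ((integrable_const _).indicator (hGm M).compl),
      integral_indicator_const _ (hGm M).compl, smul_eq_mul, mul_comm] at h1
    exact h1
  rw [probReal_compl_eq_one_sub (hGm M)] at hfin
  have h9 : (α : ℝ) * (1 - ν.real (G M)) < α * ((μ - b) / (2 * α)) := by
    apply mul_lt_mul_of_pos_left _ (by linarith)
    linarith
  have h10 : (α : ℝ) * ((μ - b) / (2 * α)) = (μ - b) / 2 := by field_simp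
  linarith

lemma birk_ev (hα : 2 ≤ α) (h : SInv α p ν) (hp0 : 0 ≤ p) (hp1 : p < 1) (b : ℝ)
    (hb : b < ∫ x, dg α x ∂ν ∨ b = 0) : ∀ᵐ x ∂ν, ∀ᶠ n : ℕ in atTop, n * b ≤ SS α n x := by
  rcases hb with hb | rfl
  · obtain ⟨b', h1, h2⟩ := exists_between hb
    have h0 := birk hα h hp0 hp1 b' h2
    have : ∀ᵐ x ∂ν, x ∉ Abad α b' := measure_eq_zero_iff_ae_notMem.1 h0
    filter_upwards [this] with x hx
    obtain ⟨q, hq1, hq2⟩ := exists_rat_btwn h1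
    by_contra hcon
    apply hx
    refine ⟨q, hq2, ?_⟩
    rw [not_eventually] at hcon
    refine hcon.mono fun n hn => ?_
    push Not at hn
    exact hn.le.trans (by gcongr)
  · refine Eventually.of_forall fun x => Eventually.of_forall fun n => ?_
    simpa using SS_nonneg hα n x

end

noncomputable def fl (α n : ℕ) (x : ℝ) : ℕ := ⌊(α : ℝ) ^ n * x⌋₊

lemma fl_div {α : ℕ} (hα : 2 ≤ α) (n j : ℕ) (x : ℝ) : fl α (n + j) x / α ^ j = fl α n x := by
  unfold fl
  have hα0 : (α : ℝ) ≠ 0 := by positivity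
  rw [← Nat.floor_div_natCast]
  congr 1; push_cast; rw [pow_add]; field_simp

lemma mem_cyl_fl {α : ℕ} (hα : 2 ≤ α) (n : ℕ) {x : ℝ} (hx : 0 ≤ x) : x ∈ cyl α n (fl α n x) := by
  have hp : (0 : ℝ) < (α : ℝ) ^ n := by positivity
  unfold cyl fl
  constructor
  · rw [div_le_iff₀ hp, mul_comm]; exact Nat.floor_le (by positivity)
  · rw [lt_div_iff₀ hp, mul_comm]; exact Nat.lt_floor_add_one _

lemma dg_fl {α : ℕ} (j : ℕ) {x : ℝ} (hx : 0 ≤ x) :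
    dg α ((α : ℝ) ^ j * x) = ((fl α j x % α : ℕ) : ℝ) := by
  unfold dg fl
  rw [← Int.natCast_floor_eq_floor (show 0 ≤ (α : ℝ) ^ j * x by positivity)]
  norm_cast

lemma SS_le_wt {α : ℕ} (hα : 2 ≤ α) (n : ℕ) {x : ℝ} (hx : 0 ≤ x) :
    SS α n x ≤ wt α n (fl α n x) := by
  have h1 : SS α (n + 1) x ≤ wt α n (fl α n x) := by
    induction n with
    | zero =>
      rw [SS_succ, dg_fl 0 hx]
      simp only [SS, Finset.range_zero, Finset.sum_empty, zero_add, wt]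
      exact_mod_cast Nat.mod_le _ _
    | succ n ih =>
      rw [SS_succ, dg_fl _ hx]
      simp only [wt]
      have := fl_div hα n 1 x
      rw [pow_one] at this
      rw [this]; push_cast at ih ⊢; linarith
  refine le_trans ?_ h1
  rw [SS_succ]
  linarith [dg_nonneg hα ((α : ℝ) ^ n * x)]

lemma ball_subset_cyl {α : ℕ} (hα : 2 ≤ α) (m j : ℕ) {x r : ℝ} (hx : 0 ≤ x)
    (hr : r ≤ ((α : ℝ) ^ (m + j))⁻¹) (hbad : fl α (m + j) x % α ^ j ≠ α ^ j - 1) :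
    Metric.ball x r ⊆ Iio 0 ∪ (cyl α (m + j) (fl α (m + j) x - 1) ∪ cyl α m (fl α m x)) := by
  intro y hy
  by_cases hy0 : y < 0
  · exact Or.inl hy0
  right
  push Not at hy0
  have hp : (0 : ℝ) < (α : ℝ) ^ (m + j) := by positivity
  rw [Metric.mem_ball, Real.dist_eq, abs_lt] at hy
  set a := fl α (m + j) x with ha
  set b := fl α (m + j) y with hb
  have hpr : (α : ℝ) ^ (m + j) * r ≤ 1 := by
    have := mul_le_mul_of_nonneg_left hr hp.le
    rwa [mul_inv_cancel₀ hp.ne'] at this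
  have h1 : (α : ℝ) ^ (m + j) * y < (α : ℝ) ^ (m + j) * x + 1 := by nlinarith
  have h2 : (α : ℝ) ^ (m + j) * x < (α : ℝ) ^ (m + j) * y + 1 := by nlinarith
  have hab : b ≤ a + 1 := by
    have h3 : (b : ℝ) ≤ (α : ℝ) ^ (m + j) * y := Nat.floor_le (by positivity)
    have h4 : (α : ℝ) ^ (m + j) * x < a + 1 := Nat.lt_floor_add_one _
    have : (b : ℝ) < ((a + 2 : ℕ) : ℝ) := by push_cast; linarith
    have : b < a + 2 := by exact_mod_cast this
    omega
  have hba : a ≤ b + 1 := by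
    have h3 : (a : ℝ) ≤ (α : ℝ) ^ (m + j) * x := Nat.floor_le (by positivity)
    have h4 : (α : ℝ) ^ (m + j) * y < b + 1 := Nat.lt_floor_add_one _
    have : (a : ℝ) < ((b + 2 : ℕ) : ℝ) := by push_cast; linarith
    have : a < b + 2 := by exact_mod_cast this
    omega
  have hyb := mem_cyl_fl hα (m + j) hy0
  have hym := mem_cyl_fl hα m hy0
  rw [← hb] at hyb
  rw [← fl_div hα m j, ← hb] at hym
  rw [← fl_div hα m j x, ← ha]
  have hcase : b = a - 1 ∨ b = a ∨ b = a + 1 := by omega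
  rcases hcase with h | h | h
  · left; rwa [h] at hyb
  · right; rwa [h] at hym
  · right
    rw [h, Nat.succ_div, if_neg, add_zero] at hym
    · exact hym
    · intro hd
      apply hbad
      have hpos : 0 < α ^ j := by positivity
      obtain ⟨c, hc⟩ := hd
      have hc0 : c ≠ 0 := by rintro rfl; simp at hc
      obtain ⟨d, rfl⟩ := Nat.exists_eq_succ_of_ne_zero hc0
      have : a = (α ^ j - 1) + α ^ j * d := by
        rw [Nat.mul_succ] at hc; omega
      rw [this, Nat.add_mul_mod_self_left, Nat.mod_eq_of_lt (by omega)]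

section
variable {α : ℕ} {p : ℝ} {ν : Measure ℝ} [IsProbabilityMeasure ν]

lemma SInv.periodic_pow (hα : 2 ≤ α)
    (h : SInv α p ν) (hp0 : 0 ≤ p) (hp1 : p < 1) {A : Set ℝ} (hA : MeasurableSet A)
    (hper : Function.Periodic (fun x => x ∈ A) α) (j : ℕ) :
    ν.real {x | (α : ℝ) ^ j * x ∈ A} = ν.real A := by
  induction j with
  | zero => simp
  | succ j ih =>
    rw [← ih, ← h.periodic hα hp0 hp1 (A := {x | (α : ℝ) ^ j * x ∈ A})
      (hA.preimage (by fun_prop)) (fun x => iff_of_eq (per_pow hper j x))]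
    congr 1
    ext x
    simp only [mem_ofPred_eq, mem_preimage, pow_succ, mul_assoc]

lemma run_meas (h : SInv α p ν) (hα : 2 ≤ α) (hp0 : 0 < p) (hp1 : p < 1)
    (hneg : ν.real (Iio 0) = 0) {M ρ : ℝ} (hM : 0 < M)
    (hMt : ∀ k : ℕ, ν.real (Ici (k : ℝ)) ≤ M * p ^ k)
    (hρ : ρ = (1 - p) / (1 - p ^ (α - 1))) (hρ0 : 0 < ρ) (n j : ℕ) :
    ν {x | 0 ≤ x ∧ fl α (n + j) x % α ^ j = α ^ j - 1} ≤
      ENNReal.ofReal (M * (1 - p)⁻¹ * (ρ * p ^ (α - 1)) ^ j) := by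
  set A : Set ℝ := {x | ⌊(α : ℝ) ^ j * x⌋ % ((α : ℤ) ^ j) = (α : ℤ) ^ j - 1} with hA
  have hAm : MeasurableSet A := by
    have h1 : Measurable (fun x : ℝ => ⌊(α : ℝ) ^ j * x⌋) :=
      Int.measurable_floor.comp (by fun_prop)
    have h2 : MeasurableSet {z : ℤ | z % ((α : ℤ) ^ j) = (α : ℤ) ^ j - 1} := MeasurableSet.of_discrete
    exact h2.preimage h1
  have hAper : Function.Periodic (fun x => x ∈ A) α := by
    intro x
    have e : (α : ℝ) ^ j * (x + α) = (α : ℝ) ^ j * x + (((α : ℤ) ^ j * α : ℤ) : ℝ) := by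
      push_cast; ring
    simp only [hA, mem_ofPred_eq]
    rw [e, Int.floor_add_intCast, Int.add_mul_emod_self_left]
  have hcast : ∀ x : ℝ, ∀ i, 0 ≤ x → (fl α i x % α ^ j = α ^ j - 1 ↔
      ⌊(α : ℝ) ^ i * x⌋ % ((α : ℤ) ^ j) = (α : ℤ) ^ j - 1) := by
    intro x i hx
    rw [← Int.natCast_floor_eq_floor (show 0 ≤ (α : ℝ) ^ i * x by positivity)]
    have hpos : 1 ≤ α ^ j := Nat.one_le_pow _ _ (by omega)
    have : ((α : ℤ) ^ j - 1) = ((α ^ j - 1 : ℕ) : ℤ) := by push_cast [hpos]; rfl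
    rw [this]
    unfold fl
    norm_cast
  have hsub1 : {x | 0 ≤ x ∧ fl α (n + j) x % α ^ j = α ^ j - 1} ⊆ {x | (α : ℝ) ^ n * x ∈ A} := by
    rintro x ⟨hx, hx2⟩
    rw [hcast x _ hx] at hx2
    simp only [hA, mem_ofPred_eq]
    rw [← mul_assoc, ← pow_add, add_comm j n]; exact hx2
  have hper := h.periodic_pow hα hp0.le hp1 hAm hAper n
  have hper' : ν {x | (α : ℝ) ^ n * x ∈ A} = ν A := by
    rwa [measureReal_eq_measureReal_iff] at hper
  refine (measure_mono hsub1).trans ?_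
  rw [hper']
  have hsub2 : A ⊆ Iio 0 ∪ ⋃ k : ℕ, cyl α j (k * α ^ j + (α ^ j - 1)) := by
    intro x hx
    by_cases hx0 : x < 0
    · exact Or.inl hx0
    right
    push Not at hx0
    have h1 := (hcast x j hx0).2 hx
    have h2 := mem_cyl_fl hα j hx0
    refine mem_iUnion.2 ⟨fl α j x / α ^ j, ?_⟩
    have h3 := Nat.div_add_mod' (fl α j x) (α ^ j)
    rw [h1] at h3
    rwa [h3]
  have hneg' : ν (Iio 0) = 0 := by rwa [measureReal_eq_zero_iff] at hneg
  have h1p : 0 < 1 - p := by linarith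
  refine (measure_mono hsub2).trans ((measure_union_le _ _).trans ?_)
  rw [hneg', zero_add]
  refine (measure_iUnion_le _).trans ?_
  have hterm : ∀ k : ℕ, ν (cyl α j (k * α ^ j + (α ^ j - 1))) ≤
      ENNReal.ofReal (M * (ρ * p ^ (α - 1)) ^ j * p ^ k) := by
    intro k
    have h1 := cyl_upper h hα hp0 hp1 hneg hM hMt hρ j (k * α ^ j + (α ^ j - 1))
    rw [wt_run α hα] at h1
    rw [← ofReal_measureReal]
    apply ENNReal.ofReal_le_ofReal
    refine h1.trans_eq ?_
    rw [pow_add, mul_comm j, pow_mul, mul_pow]; ring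
  refine (ENNReal.tsum_le_tsum hterm).trans ?_
  rw [← ENNReal.ofReal_tsum_of_nonneg (fun k => by positivity)
    ((summable_geometric_of_lt_one hp0.le hp1).mul_left _), tsum_mul_left,
    tsum_geometric_of_lt_one hp0.le hp1]
  apply ENNReal.ofReal_le_ofReal
  apply le_of_eq; ring

lemma run_bc (h : SInv α p ν) (hα : 2 ≤ α) (hp0 : 0 < p) (hp1 : p < 1)
    (hneg : ν.real (Iio 0) = 0) {M ρ : ℝ} (hM : 0 < M)
    (hMt : ∀ k : ℕ, ν.real (Ici (k : ℝ)) ≤ M * p ^ k)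
    (hρ : ρ = (1 - p) / (1 - p ^ (α - 1))) (hρ0 : 0 < ρ) (q : ℕ) (hq : 1 ≤ q) :
    ∀ᵐ x ∂ν, ∀ᶠ n : ℕ in atTop,
      ¬ (0 ≤ x ∧ fl α n x % α ^ (n / q) = α ^ (n / q) - 1) := by
  set l := ρ * p ^ (α - 1) with hl
  have hl0 : 0 < l := by positivity
  have hxp : p ^ (α - 1) ≤ p := by
    calc p ^ (α - 1) ≤ p ^ 1 := pow_le_pow_of_le_one hp0.le hp1.le (by omega)
      _ = p := pow_one p
  have hl1 : l < 1 := by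
    rw [hl, hρ, div_mul_eq_mul_div, div_lt_one (by linarith)]
    nlinarith
  set r := l ^ ((1 : ℝ) / q) with hr
  have hq0 : (0 : ℝ) < q := by exact_mod_cast hq
  have hr0 : 0 < r := Real.rpow_pos_of_pos hl0 _
  have hr1 : r < 1 := Real.rpow_lt_one hl0.le hl1 (by positivity)
  have hrq : r ^ q = l := by
    rw [hr, ← Real.rpow_natCast, ← Real.rpow_mul hl0.le]
    rw [one_div, inv_mul_cancel₀ hq0.ne', Real.rpow_one]
  have hlr : ∀ n : ℕ, l ^ (n / q) ≤ l⁻¹ * r ^ n := by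
    intro n
    rw [inv_mul_eq_div, le_div_iff₀ hl0, ← pow_succ, ← hrq, ← pow_mul]
    apply pow_le_pow_of_le_one hr0.le hr1.le
    have h1 := Nat.div_add_mod n q
    have h2 := Nat.mod_lt n (show 0 < q by omega)
    rw [mul_add]; omega
  have h1p : 0 < 1 - p := by linarith
  refine ae_eventually_notMem (s := fun n : ℕ =>
    {x | 0 ≤ x ∧ fl α n x % α ^ (n / q) = α ^ (n / q) - 1}) ?_
  refine ne_top_of_le_ne_top (b := ∑' n : ℕ, ENNReal.ofReal (M * (1 - p)⁻¹ * l⁻¹ * r ^ n)) ?_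
    (ENNReal.tsum_le_tsum fun n => ?_)
  · rw [← ENNReal.ofReal_tsum_of_nonneg (fun k => by positivity)
      ((summable_geometric_of_lt_one hr0.le hr1).mul_left _)]
    exact ENNReal.ofReal_ne_top
  · have h1 := run_meas h hα hp0 hp1 hneg hM hMt hρ hρ0 (n - n / q) (n / q)
    rw [Nat.sub_add_cancel (Nat.div_le_self n q)] at h1
    refine h1.trans (ENNReal.ofReal_le_ofReal ?_)
    rw [mul_assoc (M * (1 - p)⁻¹)]
    exact mul_le_mul_of_nonneg_left (hlr n) (by positivity)

lemma upper_main (h : SInv α p ν) (hα : 2 ≤ α) (hp0 : 0 < p) (hp1 : p < 1)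
    (hneg : ν.real (Iio 0) = 0) {ρ b : ℝ}
    (hρ : ρ = (1 - p) / (1 - p ^ (α - 1))) (hb0 : 0 ≤ b)
    (hb : b < ∫ x, dg α x ∂ν ∨ b = 0) (q : ℕ) (hq : 2 ≤ q) :
    ∃ C : ℝ, 0 < C ∧ ∀ᵐ x ∂ν, ∀ᶠ n : ℕ in atTop, ∀ r : ℝ, r ≤ ((α : ℝ) ^ n)⁻¹ →
      ν.real (Metric.ball x r) ≤
        C * Real.exp ((Real.log ρ + b * Real.log p) * ((n - n / q : ℕ) : ℝ)) := by
  obtain ⟨M, hM, hMt⟩ := h.tail hα hp0 hp1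
  have hxp : p ^ (α - 1) ≤ p := by
    calc p ^ (α - 1) ≤ p ^ 1 := pow_le_pow_of_le_one hp0.le hp1.le (by omega)
      _ = p := pow_one p
  have hρ0 : 0 < ρ := by rw [hρ]; exact div_pos (by linarith) (by linarith)
  have hρ1 : ρ ≤ 1 := by rw [hρ, div_le_one (by linarith)]; linarith
  have hlp : Real.log p < 0 := Real.log_neg hp0 hp1
  have hlρ : Real.log ρ ≤ 0 := Real.log_nonpos hρ0.le hρ1
  set κ := Real.log ρ + b * Real.log p with hκ
  have hκ0 : κ ≤ 0 := by rw [hκ]; nlinarith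
  have hexp : ∀ n w : ℕ, (n : ℝ) * b ≤ w → ρ ^ n * p ^ w ≤ Real.exp (κ * n) := by
    intro n w hw
    have e : ρ ^ n * p ^ w = Real.exp (n * Real.log ρ + w * Real.log p) := by
      rw [Real.exp_add, Real.exp_nat_mul, Real.exp_nat_mul, Real.exp_log hρ0, Real.exp_log hp0]
    rw [e]; apply Real.exp_le_exp.2
    rw [hκ]; nlinarith
  have hpos : ∀ᵐ x ∂ν, 0 ≤ x := by
    have h0 : ν (Iio 0) = 0 := by rwa [measureReal_eq_zero_iff] at hneg
    filter_upwards [measure_eq_zero_iff_ae_notMem.1 h0] with x hx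
    simpa using hx
  refine ⟨M * (p⁻¹ + 1), by positivity, ?_⟩
  filter_upwards [hpos, birk_ev hα h hp0.le hp1 b hb,
    run_bc h hα hp0 hp1 hneg hM hMt hρ hρ0 q (by omega)] with x hx hS hB
  have hmlim : Tendsto (fun n : ℕ => n - n / q) atTop atTop := by
    refine tendsto_atTop_mono (f := fun n => n / 2) (fun n => ?_) (Nat.tendsto_div_const_atTop (by norm_num))
    have : n / q ≤ n / 2 := Nat.div_le_div_left hq (by norm_num)
    omega
  filter_upwards [hS, hB, hmlim.eventually hS] with n h1 h2 h3 r hr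
  set m := n - n / q with hm
  have hmn : m + n / q = n := Nat.sub_add_cancel (Nat.div_le_self n q)
  have hbad : fl α n x % α ^ (n / q) ≠ α ^ (n / q) - 1 := fun hc => h2 ⟨hx, hc⟩
  have hsub := ball_subset_cyl (r := r) hα m (n / q) hx (by rw [hmn]; exact hr) (by rw [hmn]; exact hbad)
  rw [hmn] at hsub
  have u1 := cyl_upper h hα hp0 hp1 hneg hM hMt hρ n (fl α n x - 1)
  have u2 := cyl_upper h hα hp0 hp1 hneg hM hMt hρ m (fl α m x)
  have w1 : wt α n (fl α n x) ≤ wt α n (fl α n x - 1) + 1 := by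
    rcases Nat.eq_zero_or_pos (fl α n x) with h0 | h0
    · rw [h0]; simp
    · have := wt_succ_le α hα n (fl α n x - 1)
      rwa [Nat.sub_add_cancel h0] at this
  have p1 : p ^ (wt α n (fl α n x - 1)) ≤ p⁻¹ * p ^ (wt α n (fl α n x)) := by
    rw [inv_mul_eq_div, le_div_iff₀ hp0, ← pow_succ]
    exact pow_le_pow_of_le_one hp0.le hp1.le w1
  have v1 : ρ ^ n * p ^ (wt α n (fl α n x)) ≤ Real.exp (κ * m) := by
    refine (hexp n _ (h1.trans (SS_le_wt hα n hx))).trans (Real.exp_le_exp.2 ?_)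
    have : (m : ℝ) ≤ n := by exact_mod_cast Nat.sub_le _ _
    nlinarith
  have v2 : ρ ^ m * p ^ (wt α m (fl α m x)) ≤ Real.exp (κ * m) :=
    hexp m _ (h3.trans (SS_le_wt hα m hx))
  have t1 := measureReal_mono (μ := ν) hsub
  have t2 := measureReal_union_le (μ := ν) (Iio (0 : ℝ)) (cyl α n (fl α n x - 1) ∪ cyl α m (fl α m x))
  have t3 := measureReal_union_le (μ := ν) (cyl α n (fl α n x - 1)) (cyl α m (fl α m x))
  have t4 : ν.real (cyl α n (fl α n x - 1)) ≤ M * p⁻¹ * Real.exp (κ * m) := by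
    refine u1.trans ?_
    calc M * ρ ^ n * p ^ wt α n (fl α n x - 1) ≤ M * ρ ^ n * (p⁻¹ * p ^ (wt α n (fl α n x))) := by
          gcongr
      _ = M * p⁻¹ * (ρ ^ n * p ^ (wt α n (fl α n x))) := by ring
      _ ≤ _ := by gcongr
  have t5 : ν.real (cyl α m (fl α m x)) ≤ M * Real.exp (κ * m) := by
    refine u2.trans ?_
    rw [mul_assoc]; gcongr
  rw [hneg] at t2
  calc _ ≤ M * p⁻¹ * Real.exp (κ * m) + M * Real.exp (κ * m) := by linarith
    _ = _ := by ring

lemma lower_main (h : SInv α p ν) (hα : 2 ≤ α) (hp0 : 0 < p) (hp1 : p < 1)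
    (hneg : ν.real (Iio 0) = 0) {x : ℝ} (hx : 0 ≤ x) :
    ∃ c : ℝ, 0 < c ∧ ∀ (n : ℕ) (r : ℝ), ((α : ℝ) ^ n)⁻¹ < r →
      c * ((1 - p) * p ^ (α - 1)) ^ n ≤ ν.real (Metric.ball x r) := by
  have hup := unit_pos h hα hp0 hp1 hneg
  refine ⟨ν.real (Ico 0 1) * p ^ (fl α 0 x), by positivity, fun n r hr => ?_⟩
  have h1 := cyl_lower h hα hp0 hp1 hneg n (fl α n x)
  have h2 := fl_div hα 0 n x
  rw [zero_add] at h2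
  rw [h2] at h1
  refine le_trans (le_of_eq (by ring)) (h1.trans (measureReal_mono ?_))
  intro y hy
  have hx' := mem_cyl_fl hα n hx
  have hp : (0 : ℝ) < (α : ℝ) ^ n := by positivity
  unfold cyl at hy hx'
  rw [mem_Ico, add_div] at hy hx'
  rw [one_div] at hy hx'
  rw [Metric.mem_ball, Real.dist_eq, abs_lt]
  constructor <;> linarith [hy.1, hy.2, hx'.1, hx'.2]

end

lemma map_SInv {α β : ℕ} {p : ℝ} {π : Measure ℝ} (hβ : 0 < β)
    (hinv : ∀ A : Set ℝ, MeasurableSet A →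
      π A = ENNReal.ofReal p * π ((fun y => y + (β : ℝ)) ⁻¹' A)
          + ENNReal.ofReal (1 - p) * π ((fun y => y / (α : ℝ)) ⁻¹' A)) :
    SInv α p (π.map (fun x => x / (β : ℝ))) := by
  intro A hA
  have hb : (β : ℝ) ≠ 0 := by positivity
  have hm : Measurable (fun x : ℝ => x / (β : ℝ)) := by fun_prop
  rw [Measure.map_apply hm hA, Measure.map_apply hm (hA.preimage (by fun_prop)),
    Measure.map_apply hm (hA.preimage (by fun_prop)), hinv _ (hA.preimage hm)]
  have e1 : (fun y : ℝ => y + (β : ℝ)) ⁻¹' ((fun x => x / (β : ℝ)) ⁻¹' A)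
      = (fun x => x / (β : ℝ)) ⁻¹' ((fun y => y + (1 : ℝ)) ⁻¹' A) := by
    ext y
    simp only [mem_preimage]
    rw [add_div, div_self hb]
  have e2 : (fun y : ℝ => y / (α : ℝ)) ⁻¹' ((fun x => x / (β : ℝ)) ⁻¹' A)
      = (fun x => x / (β : ℝ)) ⁻¹' ((fun y => y / (α : ℝ)) ⁻¹' A) := by
    ext y
    simp only [mem_preimage]
    rw [div_right_comm]
  rw [e1, e2]

lemma ball_map {β : ℕ} {π : Measure ℝ} (hβ : 0 < β) (x r : ℝ) :
    (π.map (fun x => x / (β : ℝ))).real (Metric.ball (x / β) (r / β)) = π.real (Metric.ball x r) := by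
  have hb : (0 : ℝ) < β := by positivity
  have hm : Measurable (fun x : ℝ => x / (β : ℝ)) := by fun_prop
  unfold Measure.real
  rw [Measure.map_apply hm Metric.isOpen_ball.measurableSet]
  congr 2
  ext y
  simp only [mem_preimage, Metric.mem_ball, Real.dist_eq]
  rw [← sub_div, abs_div, abs_of_pos hb, div_lt_div_iff_of_pos_right hb]

lemma xi_eq {α : ℕ} (hα : 2 ≤ α) {π : Measure ℝ} [IsProbabilityMeasure π]
    (hpos : ∀ᵐ x ∂π, 0 ≤ x) {k : ℕ} (hk : k < α) :
    xi α π k = π.real {x | ⌊x⌋ % (α : ℤ) = k} := by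
  unfold xi Measure.real
  have ha : (0 : ℝ) < α := by positivity
  rw [← measure_iUnion]
  · congr 1
    apply measure_congr
    filter_upwards [hpos] with x hx
    apply propext
    change x ∈ (⋃ m : ℕ, Ico ((m : ℝ) * α + k) ((m : ℝ) * α + k + 1)) ↔ ⌊x⌋ % (α : ℤ) = k
    rw [mem_iUnion]
    have key : ∀ m : ℕ, x ∈ Ico ((m : ℝ) * α + k) ((m : ℝ) * α + k + 1) ↔ ⌊x⌋ = (m : ℤ) * α + k := by
      intro m
      rw [Int.floor_eq_iff]; push_cast; rfl
    simp only [key]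
    constructor
    · rintro ⟨m, hm⟩
      rw [hm, Int.mul_add_emod_self_right]
      exact Int.emod_eq_of_lt (by positivity) (by exact_mod_cast hk)
    · intro h
      have h0 : 0 ≤ ⌊x⌋ / (α : ℤ) := Int.ediv_nonneg (Int.floor_nonneg.2 hx) (by positivity)
      refine ⟨(⌊x⌋ / (α : ℤ)).toNat, ?_⟩
      rw [Int.toNat_of_nonneg h0, ← h, mul_comm]
      exact (Int.mul_ediv_add_emod _ _).symm
  · intro m n hmn
    apply disjoint_left.2
    intro x h1 h2
    have key : ∀ m : ℕ, x ∈ Ico ((m : ℝ) * α + k) ((m : ℝ) * α + k + 1) → ⌊x⌋ = (m : ℤ) * α + k := by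
      intro m h
      rw [Int.floor_eq_iff]; push_cast; exact h
    have := (key m h1).symm.trans (key n h2)
    apply hmn
    have h3 : (m : ℤ) * α = n * α := by linarith
    have h4 := mul_right_cancel₀ (by positivity : (α : ℤ) ≠ 0) h3
    exact_mod_cast h4
  · intro m; exact measurableSet_Ico

lemma sum_xi {α : ℕ} (hα : 2 ≤ α) {π : Measure ℝ} [IsProbabilityMeasure π]
    (hpos : ∀ᵐ x ∂π, 0 ≤ x) :
    ∑ i ∈ Finset.range α, (i : ℝ) * xi α π i = ∫ x, dg α x ∂π := by
  have hm : ∀ i : ℕ, MeasurableSet {x : ℝ | ⌊x⌋ % (α : ℤ) = i} := by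
    intro i
    have h1 : Measurable (fun x : ℝ => ⌊x⌋ % (α : ℤ)) :=
      (measurable_of_countable (fun z : ℤ => z % (α : ℤ))).comp Int.measurable_floor
    exact h1 (measurableSet_singleton (i : ℤ))
  have h1 : ∀ x, dg α x = ∑ i ∈ Finset.range α,
      ({x : ℝ | ⌊x⌋ % (α : ℤ) = i}).indicator (fun _ => (i : ℝ)) x := by
    intro x
    have ha : (0 : ℤ) < α := by positivity
    have h0 := Int.emod_nonneg ⌊x⌋ ha.ne'
    have h2 := Int.emod_lt_of_pos ⌊x⌋ ha
    obtain ⟨d, hd⟩ := Int.eq_ofNat_of_zero_le h0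
    have hdα : d < α := by omega
    rw [Finset.sum_eq_single d]
    · rw [indicator_of_mem (by exact hd)]
      unfold dg
      rw [hd]; simp
    · intro i _ hi
      rw [indicator_of_notMem]
      intro hc
      apply hi
      have : (d : ℤ) = i := hd.symm.trans hc
      exact_mod_cast this.symm
    · intro hc
      exact absurd (Finset.mem_range.2 hdα) hc
  simp only [h1]
  rw [integral_finsetSum _ (fun i _ => (integrable_const _).indicator (hm i))]
  refine Finset.sum_congr rfl fun i hi => ?_
  rw [xi_eq hα hpos (Finset.mem_range.1 hi), integral_indicator_const _ (hm i), smul_eq_mul, mul_comm]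

lemma sum_xi' {α t : ℕ} (hα : 2 ≤ α) {p : ℝ} (hp0 : 0 ≤ p) (hp1 : p < 1) {π : Measure ℝ}
    [IsProbabilityMeasure π] [IsProbabilityMeasure (π.map (fun x => x / ((α ^ t : ℕ) : ℝ)))]
    (hpos : ∀ᵐ x ∂π, 0 ≤ x)
    (h : SInv α p (π.map (fun x => x / ((α ^ t : ℕ) : ℝ)))) :
    ∑ i ∈ Finset.range α, (i : ℝ) * xi α π i =
      ∫ x, dg α x ∂(π.map (fun x => x / ((α ^ t : ℕ) : ℝ))) := by
  have ha : (α : ℝ) ^ t ≠ 0 := by positivity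
  rw [sum_xi hα hpos, ← h.periodic_integral_pow hα hp0 hp1 (dg_meas α) α (fun x => by
    rw [Real.norm_eq_abs, abs_of_nonneg (dg_nonneg hα x)]; have := dg_le hα x; linarith) (dg_per α) t]
  have hmm : Measurable (fun x : ℝ => dg α ((α : ℝ) ^ t * x)) :=
    (dg_meas α).comp (measurable_const_mul _)
  rw [integral_map (by fun_prop) hmm.aestronglyMeasurable]
  congr 1
  ext x
  congr 1
  push_cast
  field_simp

lemma logr_large (K : ℝ) : ∀ᶠ r : ℝ in nhdsWithin 0 (Ioi 0), K ≤ -Real.log r :=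
  (tendsto_neg_atBot_atTop.comp Real.tendsto_log_nhdsGT_zero).eventually_ge_atTop K

lemma F_upper {α β : ℕ} (hα : 2 ≤ α) (hβ : 0 < β) {f : ℝ → ℝ} {c T : ℝ} (hc : 0 < c) (hT : T ≤ 0)
    (hf : ∀ (n : ℕ) (r : ℝ), ((α : ℝ) ^ n)⁻¹ < r / β → c * Real.exp (T * n) ≤ f r) :
    ∀ᶠ r : ℝ in nhdsWithin 0 (Ioi 0), Real.log (f r) / Real.log r ≤ -T / Real.log α + 1 := by
  have hla : 0 < Real.log α := Real.log_pos (by exact_mod_cast hα)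
  have hb : (1 : ℝ) ≤ β := by exact_mod_cast hβ
  have hlb : 0 ≤ Real.log β := Real.log_nonneg hb
  set K := -Real.log c - T * (Real.log β / Real.log α + 1) with hK
  filter_upwards [logr_large K, logr_large 1, self_mem_nhdsWithin] with r h1 h2 hr
  have hr0 : (0 : ℝ) < r := hr
  set L := -Real.log r with hL
  have hLr : Real.log r = -L := by rw [hL]; ring
  set y := (L + Real.log β) / Real.log α with hy
  have hy0 : 0 ≤ y := by positivity
  have e1 := Nat.lt_floor_add_one y
  have e2 := Nat.floor_le hy0
  have hn : ((α : ℝ) ^ (⌊y⌋₊ + 1))⁻¹ < r / β := by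
    rw [← Real.log_lt_log_iff (by positivity) (by positivity), Real.log_inv, Real.log_pow,
      Real.log_div hr0.ne' (by positivity), hLr]
    rw [hy, div_lt_iff₀ hla] at e1
    push_cast
    linarith
  have h3 := hf _ _ hn
  have h4 : 0 < c * Real.exp (T * ((⌊y⌋₊ + 1 : ℕ) : ℝ)) := by positivity
  have h5 := Real.log_le_log h4 h3
  rw [Real.log_mul hc.ne' (Real.exp_pos _).ne', Real.log_exp] at h5
  have h6 : T * (y + 1) ≤ T * ((⌊y⌋₊ + 1 : ℕ) : ℝ) := by
    push_cast
    exact mul_le_mul_of_nonpos_left (by linarith) hT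
  rw [hLr, div_neg, ← neg_div, div_le_iff₀ (by linarith)]
  have h7 : T * (y + 1) = T / Real.log α * L + T * (Real.log β / Real.log α + 1) := by
    rw [hy]; field_simp; ring
  have h8 : (-T / Real.log α + 1) * L = - (T / Real.log α * L) + L := by ring
  rw [h8]
  linarith

lemma F_lower {α : ℕ} (hα : 2 ≤ α) {f : ℝ → ℝ} {C κ s : ℝ} (hC : 0 < C) (hκ : 0 ≤ κ) {q : ℕ}
    (hq : 2 ≤ q)
    (hpos : ∀ r, 0 < r → 0 < f r)
    (hf : ∀ᶠ n : ℕ in atTop, ∀ r : ℝ, 0 < r → r ≤ ((α : ℝ) ^ n)⁻¹ →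
      f r ≤ C * Real.exp (-κ * ((n - n / q : ℕ) : ℝ)))
    (hs : s < (1 - 1 / (q : ℝ)) * κ / Real.log α) :
    ∀ᶠ r : ℝ in nhdsWithin 0 (Ioi 0), s ≤ Real.log (f r) / Real.log r := by
  have hla : 0 < Real.log α := Real.log_pos (by exact_mod_cast hα)
  have hq2 : (2 : ℝ) ≤ q := by exact_mod_cast hq
  have hq1 : 0 ≤ 1 - 1 / (q : ℝ) := by
    rw [sub_nonneg, div_le_one (by linarith)]; linarith
  set S := (1 - 1 / (q : ℝ)) * κ / Real.log α with hS
  set A := Real.log C + κ * (1 - 1 / (q : ℝ)) with hA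
  have hlim : Tendsto (fun r : ℝ => ⌊-Real.log r / Real.log α⌋₊) (nhdsWithin 0 (Ioi 0)) atTop :=
    tendsto_nat_floor_atTop.comp
      ((tendsto_neg_atBot_atTop.comp Real.tendsto_log_nhdsGT_zero).atTop_div_const hla)
  filter_upwards [logr_large (A / (S - s)), logr_large 1, self_mem_nhdsWithin,
    hlim.eventually hf] with r h1 h2 hr h3
  have hr0 : (0 : ℝ) < r := hr
  set L := -Real.log r with hL
  have hLr : Real.log r = -L := by rw [hL]; ring
  have hy0 : 0 ≤ L / Real.log α := by positivity
  set n := ⌊L / Real.log α⌋₊ with hn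
  have e1 := Nat.lt_floor_add_one (L / Real.log α)
  have e2 := Nat.floor_le hy0
  rw [← hn] at e1 e2
  have h4 : r ≤ ((α : ℝ) ^ n)⁻¹ := by
    rw [← Real.log_le_log_iff hr0 (by positivity), Real.log_inv, Real.log_pow, hLr]
    rw [le_div_iff₀ hla] at e2
    linarith
  have h5 := Real.log_le_log (hpos r hr0) (h3 r hr0 h4)
  rw [Real.log_mul hC.ne' (Real.exp_pos _).ne', Real.log_exp] at h5
  have h6 : (1 - 1 / (q : ℝ)) * (L / Real.log α - 1) ≤ ((n - n / q : ℕ) : ℝ) := by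
    rw [Nat.cast_sub (Nat.div_le_self n q)]
    have : ((n / q : ℕ) : ℝ) ≤ n / q := Nat.cast_div_le
    have h7 : (1 - 1 / (q : ℝ)) * (L / Real.log α - 1) ≤ (1 - 1 / (q : ℝ)) * n :=
      mul_le_mul_of_nonneg_left (by linarith) hq1
    have h8 : (1 - 1 / (q : ℝ)) * n = n - n / q := by ring
    linarith
  have h9 := mul_le_mul_of_nonneg_left h6 hκ
  have h10 : κ * ((1 - 1 / (q : ℝ)) * (L / Real.log α - 1)) = S * L - κ * (1 - 1 / (q : ℝ)) := by
    rw [hS]; field_simp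
  rw [div_le_iff₀ (by linarith)] at h1
  rw [hLr, div_neg, ← neg_div, le_div_iff₀ (by linarith)]
  nlinarith

/-- Second part of the main theorem: if `β = α^t` and `p ≤ 1/2`, then
`dim_H π ≥ d̲(Σ_{i=0}^{α-1} i·ξ_i)`. -/
theorem stmt12 (α β t : ℕ) (hα : 2 ≤ α) (hβ : β = α ^ t) (p : ℝ) (hp0 : 0 < p)
    (hp : p ≤ 1 / 2)
    (π : Measure ℝ) [IsProbabilityMeasure π] (hsupp : π (Ici (0 : ℝ)) = 1)
    (hinv : ∀ A : Set ℝ, MeasurableSet A →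
      π A = ENNReal.ofReal p * π ((fun y => y + (β : ℝ)) ⁻¹' A)
          + ENNReal.ofReal (1 - p) * π ((fun y => y / (α : ℝ)) ⁻¹' A)) :
    dLow α p (∑ i ∈ Finset.range α, (i : ℝ) * xi α π i) ≤
      sSup {s : ℝ | ∀ᵐ x ∂π, s ≤ lowerLocalDim π x} := by
  have hp1 : p < 1 := by linarith
  have hβ0 : 0 < β := by rw [hβ]; positivity
  have hb1 : (1 : ℝ) ≤ β := by exact_mod_cast hβ0
  have hposx : ∀ᵐ x ∂π, 0 ≤ x := (prob_compl_eq_zero_iff measurableSet_Ici).2 hsupp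
  have hm : Measurable (fun x : ℝ => x / (β : ℝ)) := by fun_prop
  have hS := map_SInv hβ0 hinv
  set ν := π.map (fun x => x / (β : ℝ)) with hν
  have : IsProbabilityMeasure ν := Measure.isProbabilityMeasure_map hm.aemeasurable
  have hneg : ν.real (Iio 0) = 0 := by
    rw [Measure.real, hν, Measure.map_apply hm measurableSet_Iio]
    have : π ((fun x => x / (β : ℝ)) ⁻¹' Iio 0) = 0 := by
      refine measure_mono_null (t := (Ici (0 : ℝ))ᶜ) ?_ ((prob_compl_eq_zero_iff measurableSet_Ici).2 hsupp)
      intro x hx hx0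
      have h1 : x / (β : ℝ) < 0 := hx
      have h2 : 0 ≤ x / (β : ℝ) := div_nonneg hx0 (by linarith)
      linarith
    rw [this]; rfl
  have hμ : ∑ i ∈ Finset.range α, (i : ℝ) * xi α π i = ∫ x, dg α x ∂ν := by
    subst hβ
    exact sum_xi' hα hp0.le hp1 hposx hS
  rw [hμ]
  set μ := ∫ x, dg α x ∂ν with hμd
  have hμ0 : 0 ≤ μ := integral_nonneg (fun x => dg_nonneg hα x)
  have hla : 0 < Real.log α := Real.log_pos (by exact_mod_cast hα)
  have hpa : p ^ (α - 1) ≤ p := by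
    calc p ^ (α - 1) ≤ p ^ 1 := pow_le_pow_of_le_one hp0.le hp1.le (by omega)
      _ = p := pow_one p
  have hpa0 : 0 < p ^ (α - 1) := by positivity
  set ρ := (1 - p) / (1 - p ^ (α - 1)) with hρ
  have h1p : 0 < 1 - p := by linarith
  have h1pa : 0 < 1 - p ^ (α - 1) := by linarith
  have hρ0 : 0 < ρ := by positivity
  have hρ1 : ρ ≤ 1 := by rw [hρ, div_le_one h1pa]; linarith
  have hlρ : Real.log ρ ≤ 0 := Real.log_nonpos hρ0.le hρ1
  have hlp : Real.log p < 0 := Real.log_neg hp0 hp1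
  have hd : dLow α p μ = -(Real.log ρ + μ * Real.log p) / Real.log α := by
    unfold dLow dBar
    rw [hρ, Real.log_div h1p.ne' h1pa.ne', Real.log_inv]
    field_simp
    ring
  rw [hd]
  -- lower bound on balls
  set T := Real.log ((1 - p) * p ^ (α - 1)) with hT
  have hT0 : T ≤ 0 := Real.log_nonpos (by positivity) (by nlinarith)
  have hlow : ∀ x : ℝ, 0 ≤ x → ∃ c : ℝ, 0 < c ∧ ∀ (n : ℕ) (r : ℝ), ((α : ℝ) ^ n)⁻¹ < r / β →
      c * Real.exp (T * n) ≤ π.real (Metric.ball x r) := by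
    intro x hx
    obtain ⟨c, hc, h⟩ := lower_main hS hα hp0 hp1 hneg (x := x / β) (div_nonneg hx (by linarith))
    refine ⟨c, hc, fun n r hr => ?_⟩
    have := h n _ hr
    rw [hν, ball_map hβ0] at this
    rwa [mul_comm T, Real.exp_nat_mul, hT, Real.exp_log (by positivity)]
  have hpos : ∀ x : ℝ, 0 ≤ x → ∀ r, 0 < r → 0 < π.real (Metric.ball x r) := by
    intro x hx r hr
    obtain ⟨c, hc, h⟩ := hlow x hx
    obtain ⟨n, hn⟩ := exists_pow_lt_of_lt_one (div_pos hr (by linarith : (0 : ℝ) < β))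
      (inv_lt_one_of_one_lt₀ (by exact_mod_cast hα : (1 : ℝ) < α))
    rw [inv_pow] at hn
    exact lt_of_lt_of_le (by positivity) (h n r hn)
  set E := -T / Real.log α + 1 with hE
  have hup : ∀ x : ℝ, 0 ≤ x → ∀ᶠ r : ℝ in nhdsWithin 0 (Ioi 0),
      Real.log (π (Metric.ball x r)).toReal / Real.log r ≤ E := by
    intro x hx
    obtain ⟨c, hc, h⟩ := hlow x hx
    exact F_upper hα hβ0 (f := fun r => (π (Metric.ball x r)).toReal) hc hT0 h
  have hnn : ∀ x : ℝ, ∀ᶠ r : ℝ in nhdsWithin 0 (Ioi 0),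
      0 ≤ Real.log (π (Metric.ball x r)).toReal / Real.log r := by
    intro x
    filter_upwards [logr_large 1] with r hr
    apply div_nonneg_of_nonpos _ (by linarith)
    exact Real.log_nonpos ENNReal.toReal_nonneg (measureReal_le_one (μ := π))
  have hbdd : BddAbove {s : ℝ | ∀ᵐ x ∂π, s ≤ lowerLocalDim π x} := by
    refine ⟨E, fun s hs => ?_⟩
    have hs' : ∀ᵐ x ∂π, s ≤ lowerLocalDim π x := hs
    obtain ⟨x, hx, hx0⟩ := (hs'.and hposx).exists
    refine hx.trans ?_
    unfold lowerLocalDim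
    refine liminf_le_of_le ⟨0, by simpa using hnn x⟩ fun b hb => ?_
    obtain ⟨r, h1, h2⟩ := (hb.and (hup x hx0)).exists
    exact h1.trans h2
  have hmain : ∀ q : ℕ, 2 ≤ q → ∀ s : ℝ, s < (1 - 1 / (q : ℝ)) *
      (-(Real.log ρ + (μ * (1 - 1 / (q : ℝ))) * Real.log p)) / Real.log α →
      s ≤ sSup {s : ℝ | ∀ᵐ x ∂π, s ≤ lowerLocalDim π x} := by
    intro q hq s hs
    have hq2 : (2 : ℝ) ≤ q := by exact_mod_cast hq
    have hqi : 0 < 1 / (q : ℝ) := by positivity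
    have hq1 : 0 ≤ 1 - 1 / (q : ℝ) := by
      rw [sub_nonneg, div_le_one (by linarith)]; linarith
    set b := μ * (1 - 1 / (q : ℝ)) with hb
    have hb0 : 0 ≤ b := mul_nonneg hμ0 hq1
    have hbc : b < ∫ x, dg α x ∂ν ∨ b = 0 := by
      rcases hμ0.eq_or_lt with h0 | h0
      · right; rw [hb, ← h0, zero_mul]
      · left; rw [← hμd]; nlinarith
    obtain ⟨C, hC, hae⟩ := upper_main hS hα hp0 hp1 hneg hρ hb0 hbc q hq
    have hκ0 : 0 ≤ -(Real.log ρ + b * Real.log p) := by nlinarith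
    refine le_csSup hbdd ?_
    have hae' := ae_of_ae_map hm.aemeasurable hae
    change ∀ᵐ x ∂π, s ≤ lowerLocalDim π x
    filter_upwards [hae', hposx] with x hx hx0
    unfold lowerLocalDim
    refine le_liminf_of_le (IsBoundedUnder.isCoboundedUnder_ge ⟨E, by simpa using hup x hx0⟩) ?_
    refine F_lower hα (f := fun r => (π (Metric.ball x r)).toReal) hC hκ0 hq (hpos x hx0) ?_ hs
    filter_upwards [hx] with n hn r hr0 hr
    have h1 := hn (r / β) ((div_le_self hr0.le hb1).trans hr)
    rw [hν, ball_map hβ0] at h1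
    rw [neg_neg]
    exact h1
  refine le_of_forall_lt fun s hs => ?_
  have hlim : Tendsto (fun q : ℕ => (1 - 1 / (q : ℝ)) *
      (-(Real.log ρ + (μ * (1 - 1 / (q : ℝ))) * Real.log p)) / Real.log α) atTop
      (nhds ((1 - 0) * (-(Real.log ρ + (μ * (1 - 0)) * Real.log p)) / Real.log α)) := by
    have h0 : Tendsto (fun q : ℕ => 1 - 1 / (q : ℝ)) atTop (nhds (1 - 0)) :=
      tendsto_const_nhds.sub tendsto_one_div_atTop_nhds_zero_nat
    exact (h0.mul (((h0.const_mul μ).mul_const _).const_add _).neg).div_const _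
  rw [sub_zero, one_mul, mul_one] at hlim
  obtain ⟨s', hs1, hs2⟩ := exists_between hs
  obtain ⟨q, hq1, hq2⟩ := ((hlim.eventually_const_lt hs2).and (eventually_ge_atTop 2)).exists
  exact hs1.trans_le (hmain q hq2 s' hq1)
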